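/- arXiv:1606.06903 — 3 statements merged into one kernel-verified Lean document; each statement's English description precedes it below -/
import Mathlib

section
/- Let 𝐗 and 𝐘 be disjoint nonempty node sets in a DAG D. Suppose that D contains no directed path ⟨V_1, …, V_k⟩ with k ≥ 3, V_1 ∈ 𝐗, V_k ∈ 𝐗 and V_2, …, V_{k−1} ∉ 𝐗, or that 𝐘 ⊆ De(𝐗,D). Then the following are equivalent: (i) there exists a set disjoint from 𝐗 ∪ 𝐘 satisfying the adjustment criterion relative to (𝐗,𝐘) in D; (ii) there exists a generalized back-door set relative to (𝐗,𝐘) in D. -/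
attribute [local instance] Classical.propDecidable

/-- A finite directed acyclic graph on vertex type `V`. -/
structure DAG (V : Type) [Fintype V] [DecidableEq V] where
  /-- the edge relation: `Edge a b` means there is a directed edge `a → b` -/
  Edge : V → V → Prop
  /-- there are no directed cycles -/
  acyclic : ∀ v, ¬ Relation.TransGen Edge v v

namespace DAG

variable {V : Type} [Fintype V] [DecidableEq V]

/-- two nodes are adjacent if they are joined by an edge in either direction -/
def Adj (D : DAG V) (a b : V) : Prop := D.Edge a b ∨ D.Edge b a

/-- `p` is a path from `x` to `y`: a list of distinct nodes, consecutive ones adjacent,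
starting at `x` and ending at `y`. -/
def IsPathFrom (D : DAG V) (p : List V) (x y : V) : Prop :=
  p.Nodup ∧ p.Chain' D.Adj ∧ p.head? = some x ∧ p.getLast? = some y

/-- a causal (directed) path: all edges point forward -/
def IsCausal (D : DAG V) (p : List V) : Prop := p.Chain' D.Edge

/-- descendants of a set of nodes (every node is its own descendant) -/
def Desc (D : DAG V) (S : Set V) : Set V :=
  {v | ∃ w ∈ S, Relation.ReflTransGen D.Edge w v}

/-- ancestors of a set of nodes (every node is its own ancestor) -/
def Anc (D : DAG V) (S : Set V) : Set V :=
  {v | ∃ w ∈ S, Relation.ReflTransGen D.Edge v w}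

/-- `w` is a collider on the path `p`: both edges of `p` at `w` point into `w` -/
def IsColliderOn (D : DAG V) (p : List V) (w : V) : Prop :=
  ∃ a b, [a, w, b] <:+: p ∧ D.Edge a w ∧ D.Edge b w

/-- `w` is a non-collider on `p`: a non-endpoint node of `p` that is not a collider on `p` -/
def IsNonColliderOn (D : DAG V) (p : List V) (w : V) : Prop :=
  (∃ a b, [a, w, b] <:+: p) ∧ ¬ D.IsColliderOn p w

/-- `Z` blocks the path `p`: some non-collider on `p` is in `Z`, or some collider on `p`
has no descendant in `Z`.  Otherwise `p` is d-connecting given `Z`. -/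
def Blocks (D : DAG V) (Z : Set V) (p : List V) : Prop :=
  (∃ w, D.IsNonColliderOn p w ∧ w ∈ Z) ∨
  (∃ w, D.IsColliderOn p w ∧ D.Desc {w} ∩ Z = ∅)

/-- `p` is a proper causal path from `X` to `Y` -/
def ProperCausalPath (D : DAG V) (X Y : Set V) (p : List V) : Prop :=
  (∃ x ∈ X, ∃ y ∈ Y, D.IsPathFrom p x y) ∧ (∀ v ∈ p.tail, v ∉ X) ∧ D.IsCausal p

/-- `p` is a proper non-causal path from `X` to `Y` -/
def ProperNonCausalPath (D : DAG V) (X Y : Set V) (p : List V) : Prop :=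
  (∃ x ∈ X, ∃ y ∈ Y, D.IsPathFrom p x y) ∧ (∀ v ∈ p.tail, v ∉ X) ∧ ¬ D.IsCausal p

/-- the forbidden set: all descendants of nodes `W ∉ X` lying on a proper causal path
from `X` to `Y` -/
def Forb (D : DAG V) (X Y : Set V) : Set V :=
  {v | ∃ p w, D.ProperCausalPath X Y p ∧ w ∈ p ∧ w ∉ X ∧
    Relation.ReflTransGen D.Edge w v}

/-- the adjustment criterion of Shpitser et al. / van der Zander et al. -/
def SatisfiesAC (D : DAG V) (X Y Z : Set V) : Prop :=
  Z ∩ D.Forb X Y = ∅ ∧ ∀ p, D.ProperNonCausalPath X Y p → D.Blocks Z p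

/-- the constructive set `Adjust(X,Y,D)` -/
def AdjustSet (D : DAG V) (X Y : Set V) : Set V :=
  D.Anc (X ∪ Y) \ (X ∪ Y ∪ D.Forb X Y)

/-- `Z` d-separates `X` and `Y` in `D`: `Z` blocks every path from `X` to `Y` -/
def DSep (D : DAG V) (X Y Z : Set V) : Prop :=
  ∀ x ∈ X, ∀ y ∈ Y, ∀ p, D.IsPathFrom p x y → D.Blocks Z p

/-- `p` is a back-door path from `x`: its first edge points into `x` -/
def IsBackdoorFrom (D : DAG V) (p : List V) (x : V) : Prop :=
  ∃ b rest, p = x :: b :: rest ∧ D.Edge b x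

/-- Pearl's back-door criterion -/
def BackdoorCriterion (D : DAG V) (X Y Z : Set V) : Prop :=
  Z ∩ D.Desc X = ∅ ∧
  ∀ x ∈ X, ∀ y ∈ Y, ∀ p, D.IsPathFrom p x y → D.IsBackdoorFrom p x → D.Blocks Z p

/-- the generalized back-door criterion of Maathuis and Colombo -/
def GenBackdoorCriterion (D : DAG V) (X Y Z : Set V) : Prop :=
  Z ∩ D.Desc X = ∅ ∧
  ∀ x ∈ X, ∀ y ∈ Y, ∀ p, D.IsPathFrom p x y → D.IsBackdoorFrom p x →
    D.Blocks ((Z ∪ X) \ {x}) p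

end DAG


namespace DAG

variable {V : Type} [Fintype V] [DecidableEq V]

open Relation

theorem not_edge_of_edge (D : DAG V) {a b : V} (h : D.Edge a b) : ¬ D.Edge b a :=
  fun h' => D.acyclic a ((TransGen.single h).tail h')

theorem desc_of_reflTransGen (D : DAG V) {S : Set V} {a b : V} (ha : a ∈ D.Desc S)
    (h : ReflTransGen D.Edge a b) : b ∈ D.Desc S := by
  obtain ⟨w, hw, hwa⟩ := ha
  exact ⟨w, hw, hwa.trans h⟩

/-- A step along a directed edge that does not enter `X`. -/
def AvoidStep (D : DAG V) (X : Set V) (a b : V) : Prop := D.Edge a b ∧ b ∉ X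

theorem reflTransGen_of_avoidStep (D : DAG V) {X : Set V} {a b : V}
    (h : ReflTransGen (D.AvoidStep X) a b) : ReflTransGen D.Edge a b :=
  ReflTransGen.mono (fun _ _ h => h.1) _ _ h

theorem notMem_of_avoidStep (D : DAG V) {X : Set V} {a b : V}
    (h : ReflTransGen (D.AvoidStep X) a b) (ha : a ∉ X) : b ∉ X := by
  rcases h.cases_tail with rfl | ⟨c, -, hc⟩
  · exact ha
  · exact hc.2

/-- A node outside `X` that has an ancestor in `X` is reached from the last node of `X` on a
directed path to it. -/
theorem exists_avoidStep_of_desc (D : DAG V) {X : Set V} {m : V} (hm : m ∈ D.Desc X) :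
    ∃ x ∈ X, ReflTransGen (D.AvoidStep X) x m := by
  obtain ⟨w, hw, hwm⟩ := hm
  induction hwm with
  | refl => exact ⟨w, hw, .refl⟩
  | @tail b c _ hbc ih =>
    obtain ⟨x, hx, hxb⟩ := ih
    by_cases hc : c ∈ X
    · exact ⟨c, hc, .refl⟩
    · exact ⟨x, hx, hxb.tail ⟨hbc, hc⟩⟩

/-- A directed path from a node outside `X` into `X` has a first entry into `X`. -/
theorem exists_first_entry (D : DAG V) {X : Set V} {m : V} (hm : m ∈ D.Anc X) (hmX : m ∉ X) :
    ∃ x ∈ X, ∃ n, ReflTransGen (D.AvoidStep X) m n ∧ D.Edge n x := by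
  obtain ⟨w, hw, hwm⟩ := hm
  induction hwm using ReflTransGen.head_induction_on with
  | refl => exact absurd hw hmX
  | @head a c hac _ ih =>
    by_cases hc : c ∈ X
    · exact ⟨c, hc, a, .refl, hac⟩
    · obtain ⟨x, hx, n, hn, hnx⟩ := ih hc
      exact ⟨x, hx, n, hn.head ⟨hac, hc⟩, hnx⟩

theorem exists_chain_of_avoidStep (D : DAG V) {X : Set V} {a b : V}
    (h : ReflTransGen (D.AvoidStep X) a b) :
    ∃ l, (a :: l).getLast? = some b ∧ (a :: l).IsChain D.Edge ∧
      ∀ v ∈ l, v ∉ X ∧ TransGen D.Edge a v ∧ ReflTransGen (D.AvoidStep X) v b := by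
  induction h using ReflTransGen.head_induction_on with
  | refl => exact ⟨[], rfl, .singleton _, by simp⟩
  | @head a c hac hcb ih =>
    obtain ⟨l, hl, hc, hv⟩ := ih
    refine ⟨c :: l, by simpa [List.getLast?_cons_cons] using hl, hc.cons_cons hac.1, ?_⟩
    rintro v hvm
    rcases List.mem_cons.1 hvm with rfl | hvl
    · exact ⟨hac.2, .single hac.1, hcb⟩
    · exact ⟨(hv v hvl).1, .head hac.1 (hv v hvl).2.1, (hv v hvl).2.2⟩

theorem IsCausal.pairwise {D : DAG V} {l : List V} (h : l.IsChain D.Edge) :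
    l.Pairwise (TransGen D.Edge) :=
  List.isChain_iff_pairwise.1 (h.imp fun _ _ => TransGen.single)

theorem IsCausal.nodup {D : DAG V} {l : List V} (h : l.IsChain D.Edge) : l.Nodup :=
  (IsCausal.pairwise h).imp fun {a b} hab => by
    rintro rfl
    exact D.acyclic _ hab

theorem IsCausal.adj {D : DAG V} {l : List V} (h : l.IsChain D.Edge) : l.IsChain D.Adj :=
  h.imp fun _ _ => Or.inl

theorem triple_unique {α : Type} {p : List α} (hp : p.Nodup) {a a' w b b' : α}
    (h : [a, w, b] <:+: p) (h' : [a', w, b'] <:+: p) : a = a' ∧ b = b' := by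
  obtain ⟨s, t, rfl⟩ := h
  obtain ⟨s', t', h'⟩ := h'
  have hp' : (s' ++ [a', w, b'] ++ t').Nodup := h' ▸ hp
  have e : (s' ++ [a']) ++ w :: (b' :: t') = (s ++ [a]) ++ w :: (b :: t) := by simpa using h'
  have e1 : ((s' ++ [a']) ++ w :: (b' :: t')).Nodup := by simpa using hp'
  have e2 : ((s ++ [a]) ++ w :: (b :: t)).Nodup := by simpa using hp
  have n1 : w ∉ s' ++ [a'] := fun hw => (List.nodup_append.1 e1).2.2 w hw w (by simp) rfl
  have n2 : w ∉ s ++ [a] := fun hw => (List.nodup_append.1 e2).2.2 w hw w (by simp) rfl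
  have key : s' ++ [a'] = s ++ [a] ∧ b' :: t' = b :: t := by
    rcases List.append_eq_append_iff.1 e with ⟨u, hu, hu'⟩ | ⟨u, hu, hu'⟩
    · cases u with
      | nil => simp_all
      | cons c u => simp at hu'; exact absurd (by rw [hu, ← hu'.1]; simp) n2
    · cases u with
      | nil => simp_all
      | cons c u => simp at hu'; exact absurd (by rw [hu, ← hu'.1]; simp) n1
  have ha := key.1
  have hb := key.2
  simp at ha hb
  exact ⟨ha.2.symm, hb.1.symm⟩

theorem isNonColliderOn_of_triple {D : DAG V} {p : List V} (hp : p.Nodup) {a w b : V}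
    (h : [a, w, b] <:+: p) (hne : ¬ (D.Edge a w ∧ D.Edge b w)) : D.IsNonColliderOn p w := by
  refine ⟨⟨a, b, h⟩, ?_⟩
  rintro ⟨a', b', h', ha, hb⟩
  obtain ⟨rfl, rfl⟩ := triple_unique hp h h'
  exact hne ⟨ha, hb⟩

theorem IsColliderOn.of_isInfix {D : DAG V} {p q : List V} (h : q <:+: p) {w : V}
    (hw : D.IsColliderOn q w) : D.IsColliderOn p w := by
  obtain ⟨a, b, hab, h1, h2⟩ := hw
  exact ⟨a, b, hab.trans h, h1, h2⟩

theorem IsNonColliderOn.of_isInfix {D : DAG V} {p q : List V} (hp : p.Nodup) (h : q <:+: p)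
    {w : V} (hw : D.IsNonColliderOn q w) : D.IsNonColliderOn p w := by
  obtain ⟨⟨a, b, hab⟩, hn⟩ := hw
  exact isNonColliderOn_of_triple hp (hab.trans h) fun he => hn ⟨a, b, hab, he⟩

/-- Prepending nodes against the direction of their edges creates no collider. -/
theorem reverse_append_adj_and_no_collider (D : DAG V) (A B : List V) (m : V)
    (hA : (m :: A).IsChain D.Edge) (hB : (m :: B).IsChain D.Adj)
    (hB' : ∀ w, ¬ D.IsColliderOn (m :: B) w) :
    (A.reverse ++ m :: B).IsChain D.Adj ∧ ∀ w, ¬ D.IsColliderOn (A.reverse ++ m :: B) w := by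
  induction A generalizing m B with
  | nil => exact ⟨hB, hB'⟩
  | cons c A ih =>
    rw [List.isChain_cons_cons] at hA
    have := ih (m :: B) c hA.2 (List.isChain_cons_cons.2 ⟨Or.inr hA.1, hB⟩) (by
      rintro w ⟨a, b, hab, h1, h2⟩
      rcases List.infix_cons_iff.1 hab with hpre | hinf
      · obtain ⟨t, ht⟩ := hpre
        simp at ht
        obtain ⟨rfl, rfl, -⟩ := ht
        exact D.not_edge_of_edge hA.1 h1
      · exact hB' w ⟨a, b, hinf, h1, h2⟩)
    simpa using this

theorem no_collider_of_chain (D : DAG V) {l : List V} (h : l.IsChain D.Edge) (w : V) :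
    ¬ D.IsColliderOn l w := by
  rintro ⟨a, b, hab, -, h2⟩
  have := h.infix hab
  simp at this
  exact D.not_edge_of_edge this.2 h2

/-- A path that starts with an outgoing edge and is not causal has a collider that is a
descendant of its first node. -/
theorem exists_collider_desc (D : DAG V) {a b : V} {l : List V} (hab : D.Edge a b)
    (hadj : (a :: b :: l).IsChain D.Adj) (hn : ¬ (a :: b :: l).IsChain D.Edge) :
    ∃ w, D.IsColliderOn (a :: b :: l) w ∧ ReflTransGen D.Edge a w := by
  induction l generalizing a b with
  | nil => simp [hab] at hn
  | cons c l ih =>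
    rw [List.isChain_cons_cons] at hadj
    by_cases hbc : D.Edge b c
    · obtain ⟨w, hw, hbw⟩ := ih hbc hadj.2 fun h => hn (h.cons_cons hab)
      exact ⟨w, hw.of_isInfix (List.suffix_cons _ _).isInfix, hbw.head hab⟩
    · have hcb : D.Edge c b := (List.isChain_cons_cons.1 hadj.2).1.resolve_left hbc
      exact ⟨b, ⟨a, c, ⟨[], l, rfl⟩, hab, hcb⟩, .single hab⟩

theorem mem_forb_of_desc (D : DAG V) {X Y : Set V} {m y v : V} (hmX : m ∉ X)
    (hm : m ∈ D.Desc X) (hy : y ∈ Y) (hmy : ReflTransGen (D.AvoidStep X) m y)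
    (hmv : ReflTransGen D.Edge m v) : v ∈ D.Forb X Y := by
  obtain ⟨x, hx, hxm⟩ := D.exists_avoidStep_of_desc hm
  rcases hxm.cases_head with rfl | ⟨c, hxc, hcm⟩
  · exact absurd hx hmX
  have hxy : ReflTransGen (D.AvoidStep X) c y := hcm.trans hmy
  obtain ⟨l, hl, hc, hv⟩ := D.exists_chain_of_avoidStep hxy
  refine ⟨x :: c :: l, c, ⟨⟨x, hx, y, hy, ?_, ?_, rfl, ?_⟩, ?_, ?_⟩, by simp, hxc.2,
    (D.reflTransGen_of_avoidStep hcm).trans hmv⟩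
  · exact IsCausal.nodup (hc.cons_cons hxc.1)
  · exact IsCausal.adj (hc.cons_cons hxc.1)
  · simpa [List.getLast?_cons_cons] using hl
  · rintro v hvm
    rcases List.mem_cons.1 hvm with rfl | hvl
    · exact hxc.2
    · exact (hv v hvl).1
  · exact hc.cons_cons hxc.1

/-- If a node outside `X` lies on a proper causal path to `Y` and is also an ancestor of `X`,
then no set satisfies the adjustment criterion. -/
theorem SatisfiesAC.notMem_anc {D : DAG V} {X Y Z : Set V} (hZX : Disjoint Z X)
    (hZ : D.SatisfiesAC X Y Z) {m y : V} (hmX : m ∉ X) (hm : m ∈ D.Desc X) (hy : y ∈ Y)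
    (hmy : ReflTransGen (D.AvoidStep X) m y) : m ∉ D.Anc X := by
  have wf : WellFounded (Function.swap (TransGen D.Edge)) :=
    haveI : IsTrans V (Function.swap (TransGen D.Edge)) := ⟨fun _ _ _ h h' => h'.trans h⟩
    haveI : Std.Irrefl (Function.swap (TransGen D.Edge)) := ⟨fun a h => D.acyclic a h⟩
    Finite.wellFounded_of_trans_of_irrefl _
  induction m using wf.induction generalizing y with
  | _ m ih =>
  intro hanc
  obtain ⟨x, hx, n, hmn, hnx⟩ := D.exists_first_entry hanc hmX
  obtain ⟨l₁, hl₁, hc₁, hv₁⟩ := D.exists_chain_of_avoidStep hmn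
  obtain ⟨l₂, hl₂, hc₂, hv₂⟩ := D.exists_chain_of_avoidStep hmy
  have hdisj : ∀ v ∈ l₁, v ∉ l₂ := fun v h1 h2 => by
    obtain ⟨hvX, hmv, hvn⟩ := hv₁ v h1
    exact ih v hmv hvX (D.desc_of_reflTransGen hm hmv.to_reflTransGen) hy (hv₂ v h2).2.2
      ⟨x, hx, (D.reflTransGen_of_avoidStep hvn).tail hnx⟩
  have hcx : (m :: (l₁ ++ [x])).IsChain D.Edge := by
    rw [← List.cons_append]
    refine List.isChain_append.2 ⟨hc₁, .singleton _, ?_⟩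
    intro a ha b hb
    simp only [hl₁, Option.mem_def, Option.some.injEq, List.head?_cons] at ha hb
    exact ha ▸ hb ▸ hnx
  obtain ⟨hadj, hnc⟩ := D.reverse_append_adj_and_no_collider (l₁ ++ [x]) l₂ m hcx
    (IsCausal.adj hc₂) (D.no_collider_of_chain hc₂)
  have hmem : ∀ v ∈ (l₁ ++ [x]).reverse ++ m :: l₂, v = x ∨ v ∉ X ∧ ReflTransGen D.Edge m v := by
    intro v hv
    simp only [List.reverse_append, List.reverse_cons, List.reverse_nil, List.nil_append,
      List.cons_append, List.mem_cons, List.mem_append, List.mem_reverse] at hv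
    rcases hv with h | h | h | h
    · exact .inl h
    · exact .inr ⟨(hv₁ v h).1, (hv₁ v h).2.1.to_reflTransGen⟩
    · exact .inr ⟨h ▸ hmX, h ▸ .refl⟩
    · exact .inr ⟨(hv₂ v h).1, (hv₂ v h).2.1.to_reflTransGen⟩
  have hnd : ((l₁ ++ [x]).reverse ++ m :: l₂).Nodup := by
    have h1 := IsCausal.nodup hcx
    have h2 := IsCausal.nodup hc₂
    rw [List.nodup_cons] at h1
    refine List.nodup_append.2 ⟨List.nodup_reverse.2 h1.2, h2, ?_⟩
    rintro a ha b hb rfl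
    rw [List.mem_reverse] at ha
    rcases List.mem_cons.1 hb with rfl | hb
    · exact h1.1 ha
    · rcases List.mem_append.1 ha with ha | ha
      · exact hdisj a ha hb
      · rw [List.mem_singleton] at ha
        exact (hv₂ a hb).1 (ha ▸ hx)
  have hp : D.ProperNonCausalPath X Y ((l₁ ++ [x]).reverse ++ m :: l₂) := by
    refine ⟨⟨x, hx, y, hy, hnd, hadj, by simp, ?_⟩, ?_, ?_⟩
    · rw [List.getLast?_append, hl₂]; rfl
    · intro v hv hvX
      have hvx : v = x := (hmem v (List.mem_of_mem_tail hv)).resolve_right fun h => h.1 hvX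
      subst hvx
      simp at hnd hv
      tauto
    · intro hcaus
      have hpw := IsCausal.pairwise hcaus
      simp only [List.reverse_append, List.reverse_cons, List.reverse_nil, List.nil_append,
        List.cons_append, List.pairwise_cons] at hpw
      have hxm : TransGen D.Edge x m := hpw.1 m (by simp)
      exact D.acyclic x (hxm.trans_left ((D.reflTransGen_of_avoidStep hmn).tail hnx))
  rcases hZ.2 _ hp with ⟨w, hw, hwZ⟩ | ⟨w, hw, -⟩
  · obtain ⟨⟨a, b, hab⟩, -⟩ := hw
    rcases hmem w (hab.subset (by simp)) with rfl | ⟨-, hmw⟩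
    · exact Set.disjoint_left.1 hZX hwZ hx
    · exact (hZ.1 ▸ ⟨hwZ, D.mem_forb_of_desc hmX hm hy hmy hmw⟩ : w ∈ (∅ : Set V))
  · exact hnc w hw

theorem exists_first_mem {α : Type} {p : List α} {Y : Set α} {y : α} (hyp : y ∈ p) (hy : y ∈ Y) :
    ∃ s y' t, p = s ++ y' :: t ∧ y' ∈ Y ∧ ∀ v ∈ s, v ∉ Y := by
  induction p with
  | nil => simp at hyp
  | cons a p ih =>
    by_cases ha : a ∈ Y
    · exact ⟨[], a, p, rfl, ha, by simp⟩
    · obtain ⟨s, y', t, rfl, hy', hs⟩ :=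
        ih ((List.mem_cons.1 hyp).resolve_left fun h => ha (h ▸ hy))
      exact ⟨a :: s, y', t, rfl, hy', by simpa [ha] using hs⟩

theorem mem_of_triple_infix_concat {α : Type} {s : List α} {a w b y : α}
    (h : [a, w, b] <:+: s ++ [y]) : w ∈ s := by
  obtain ⟨s', t, h⟩ := h
  have h' := congrArg List.dropLast h
  rw [List.dropLast_concat, List.append_assoc, List.dropLast_append_of_ne_nil (by simp)] at h'
  rw [← h']
  simp

/-- Nodes of a generalized back-door set that lie in `Y` may be dropped. -/
theorem GenBackdoorCriterion.diff {D : DAG V} {X Y Z : Set V} (hXY : Disjoint X Y)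
    (hZ : D.GenBackdoorCriterion X Y Z) : D.GenBackdoorCriterion X Y (Z \ Y) := by
  refine ⟨Set.eq_empty_of_subset_empty (hZ.1 ▸ fun v hv => ⟨hv.1.1, hv.2⟩), ?_⟩
  rintro x hx y hy p ⟨hnd, hadj, -, hlast⟩ ⟨b, l, hpb, hbx⟩
  obtain ⟨s, y', t, hpst, hy', hs⟩ := exists_first_mem (List.mem_of_getLast? hlast) hy
  have hpre : s ++ [y'] <:+: p := ⟨[], t, by simp [hpst]⟩
  have hback : ∃ l', s ++ [y'] = x :: b :: l' := by
    rw [hpb] at hpst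
    match s, hpst with
    | [], hpst =>
      simp at hpst
      exact absurd (hpst.1 ▸ hy') (Set.disjoint_left.1 hXY hx)
    | [a], hpst => simp at hpst; exact ⟨[], by simp [hpst]⟩
    | a :: c :: s, hpst => simp at hpst; exact ⟨s ++ [y'], by simp [hpst]⟩
  obtain ⟨l', hl'⟩ := hback
  have hq : D.IsPathFrom (s ++ [y']) x y' :=
    ⟨hnd.sublist hpre.sublist, hadj.infix hpre, by simp [hl'], by simp⟩
  rcases hZ.2 x hx y' hy' _ hq ⟨b, l', hl', hbx⟩ with ⟨w, hw, hwZ, hwx⟩ | ⟨w, hw, hwZ⟩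
  · obtain ⟨a, c, hac⟩ := hw.1
    exact .inl ⟨w, hw.of_isInfix hnd hpre,
      hwZ.imp_left fun h => ⟨h, hs w (mem_of_triple_infix_concat hac)⟩, hwx⟩
  · exact .inr ⟨w, hw.of_isInfix hpre, Set.eq_empty_of_subset_empty
      (hwZ ▸ fun v hv => ⟨hv.1, hv.2.1.imp_left And.left, hv.2.2⟩)⟩

theorem GenBackdoorCriterion.satisfiesAC {D : DAG V} {X Y Z : Set V}
    (hZ : D.GenBackdoorCriterion X Y Z) : D.SatisfiesAC X Y Z := by
  have hZX : ∀ v ∈ Z, v ∉ D.Desc X := fun v hv h => (hZ.1 ▸ ⟨hv, h⟩ : v ∈ (∅ : Set V))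
  refine ⟨?_, ?_⟩
  · refine Set.eq_empty_of_forall_notMem ?_
    rintro v ⟨hvZ, p, w, ⟨⟨x, hx, y, hy, hp⟩, hpX, hc⟩, hw, hwX, hwv⟩
    refine hZX v hvZ ⟨x, hx, .trans ?_ hwv⟩
    obtain ⟨-, -, hhead, -⟩ := hp
    cases p with
    | nil => simp at hw
    | cons a p =>
      simp only [List.head?_cons, Option.some.injEq] at hhead
      subst hhead
      rcases List.mem_cons.1 hw with rfl | hw
      · exact .refl
      · exact ((List.pairwise_cons.1 (IsCausal.pairwise hc)).1 w hw).to_reflTransGen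
  · rintro p ⟨⟨x, hx, y, hy, hp⟩, hpX, hc⟩
    obtain ⟨hnd, hadj, hhead, hlast⟩ := id hp
    match p, hhead with
    | [a], hhead => exact absurd (.singleton a) hc
    | a :: b :: l, hhead =>
      simp only [List.head?_cons, Option.some.injEq] at hhead
      subst hhead
      rcases (List.isChain_cons_cons.1 hadj).1 with hab | hba
      · obtain ⟨w, hw, haw⟩ := D.exists_collider_desc hab hadj hc
        refine .inr ⟨w, hw, Set.eq_empty_of_forall_notMem ?_⟩
        rintro v ⟨⟨_, rfl, hwv⟩, hvZ⟩
        exact hZX v hvZ ⟨a, hx, haw.trans hwv⟩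
      · rcases hZ.2 a hx y hy _ hp ⟨b, l, rfl, hba⟩ with ⟨w, hw, hwZ, hwa⟩ | ⟨w, hw, hwZ⟩
        · refine .inl ⟨w, hw, hwZ.resolve_right fun hwX => ?_⟩
          obtain ⟨⟨c, d, hcd⟩, -⟩ := hw
          have : w ∈ a :: b :: l := hcd.subset (by simp)
          exact hpX w ((List.mem_cons.1 this).resolve_left hwa) hwX
        · refine .inr ⟨w, hw, Set.eq_empty_of_forall_notMem fun v hv => ?_⟩
          refine (hwZ ▸ ⟨hv.1, .inl hv.2, ?_⟩ : v ∈ (∅ : Set V))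
          rintro rfl
          exact hZX _ hv.2 ⟨_, hx, .refl⟩

/-- Following a back-door path that is open given `(De(X)ᶜ ∪ X) \ {x}` from its end in
`Y ⊆ De(X)` towards its start `x`, every node lies on a proper causal path or points away from
`Y` below such a node, as long as no node on a proper causal path is an ancestor of `X`. -/
theorem open_backdoor_suffix (D : DAG V) {X Y : Set V} (hXY : Disjoint X Y)
    (hYX : Y ⊆ D.Desc X)
    (hgood : ∀ m y, m ∉ X → m ∈ D.Desc X → y ∈ Y → ReflTransGen (D.AvoidStep X) m y →
      m ∉ D.Anc X)
    {x y : V} {p : List V} (hp : D.IsPathFrom p x y) (hy : y ∈ Y)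
    (hopen : ¬ D.Blocks (((D.Desc X)ᶜ ∪ X) \ {x}) p) (q s : List V) (u v : V)
    (hpq : p = s ++ u :: v :: q) :
    ∃ m ∉ X, m ∈ D.Desc X ∧ (∃ y ∈ Y, ReflTransGen (D.AvoidStep X) m y) ∧
      (m = v ∨ TransGen D.Edge m v ∧ ∃ c q', q = c :: q' ∧ D.Edge c v) := by
  obtain ⟨hnd, hadj, hhead, hlast⟩ := id hp
  induction q generalizing s u v with
  | nil =>
    have : v = y := by simpa [hpq] using hlast
    subst this
    exact ⟨v, fun h => Set.disjoint_left.1 hXY h hy, hYX hy, ⟨v, hy, .refl⟩, .inl rfl⟩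
  | cons c q ih =>
    obtain ⟨m, hmX, hmD, ⟨y', hy', hmy⟩, hm⟩ := ih (s ++ [u]) v c (by simpa using hpq)
    have htri : [u, v, c] <:+: p := ⟨s, q, by simp [hpq]⟩
    have hvx : v ≠ x := by
      rintro rfl
      cases s with
      | nil => simp [hpq] at hhead hnd; simp [hhead] at hnd
      | cons a s => simp [hpq] at hhead hnd; simp [hhead] at hnd
    have hvc : D.Adj v c :=
      (List.isChain_cons_cons.1 (hadj.infix ⟨s ++ [u], q, by simp [hpq]⟩ :
        List.IsChain D.Adj [v, c])).1
    rcases hm with rfl | ⟨hmc, d, q', rfl, hdc⟩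
    · rcases hvc with hvc | hcv
      · have hnon := isNonColliderOn_of_triple hnd htri fun h => D.not_edge_of_edge hvc h.2
        have hvX : v ∉ X := fun hvX => hopen (.inl ⟨v, hnon, .inr hvX, hvx⟩)
        have hvD : v ∈ D.Desc X := by
          by_contra hvD
          exact hopen (.inl ⟨v, hnon, .inl hvD, hvx⟩)
        exact ⟨v, hvX, hvD, ⟨y', hy', hmy.head ⟨hvc, hmX⟩⟩, .inl rfl⟩
      · exact ⟨m, hmX, hmD, ⟨y', hy', hmy⟩, .inr ⟨.single hcv, m, q, rfl, hcv⟩⟩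
    · rcases hvc with hvc | hcv
      · exfalso
        have hcol : D.IsColliderOn p c :=
          ⟨v, d, ⟨s ++ [u], q', by simp [hpq]⟩, hvc, hdc⟩
        have hne : (D.Desc {c} ∩ (((D.Desc X)ᶜ ∪ X) \ {x})).Nonempty :=
          Set.nonempty_iff_ne_empty.2 fun h => hopen (.inr ⟨c, hcol, h⟩)
        obtain ⟨t, ⟨_, rfl, hct⟩, ht, -⟩ := hne
        have hmt := hmc.to_reflTransGen.trans hct
        refine hgood m y' hmX hmD hy' hmy ⟨t, ht.resolve_left fun h => ?_, hmt⟩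
        exact h (D.desc_of_reflTransGen hmD hmt)
      · exact ⟨m, hmX, hmD, ⟨y', hy', hmy⟩, .inr ⟨hmc.tail hcv, c, d :: q', rfl, hcv⟩⟩

/-- A node outside `X` that is a descendant and a parent of nodes in `X` yields a directed path
between two nodes of `X` with at least one intermediate node, all of them outside `X`. -/
theorem exists_causal_between (D : DAG V) {X : Set V} {b x : V} (hbX : b ∉ X)
    (hb : b ∈ D.Desc X) (hx : x ∈ X) (hbx : D.Edge b x) :
    ∃ p x₁ x₂, x₁ ∈ X ∧ x₂ ∈ X ∧ D.IsPathFrom p x₁ x₂ ∧ D.IsCausal p ∧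
      3 ≤ p.length ∧ ∀ v ∈ p.tail.dropLast, v ∉ X := by
  obtain ⟨x₁, hx₁, h⟩ := D.exists_avoidStep_of_desc hb
  obtain ⟨l, hl, hc, hv⟩ := D.exists_chain_of_avoidStep h
  have hcx : (x₁ :: (l ++ [x])).IsChain D.Edge := by
    rw [← List.cons_append]
    refine List.isChain_append.2 ⟨hc, .singleton _, ?_⟩
    intro a ha c hc
    simp only [hl, Option.mem_def, Option.some.injEq, List.head?_cons] at ha hc
    exact ha ▸ hc ▸ hbx
  refine ⟨x₁ :: (l ++ [x]), x₁, x, hx₁, hx, ⟨IsCausal.nodup hcx, IsCausal.adj hcx, rfl, ?_⟩, hcx,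
    ?_, ?_⟩
  · rw [← List.cons_append, List.getLast?_append]; rfl
  · cases l with
    | nil => simp at hl; exact absurd (hl ▸ hx₁) hbX
    | cons c l => simp
  · intro v hvm
    simp at hvm
    exact (hv v hvm).1

theorem genBackdoorCriterion_compl_desc (D : DAG V) {X Y Z : Set V} (hXY : Disjoint X Y)
    (hcond : (¬ ∃ p x₁ x₂, x₁ ∈ X ∧ x₂ ∈ X ∧ D.IsPathFrom p x₁ x₂ ∧ D.IsCausal p ∧
        3 ≤ p.length ∧ ∀ v ∈ p.tail.dropLast, v ∉ X) ∨ Y ⊆ D.Desc X)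
    (hZX : Disjoint Z X) (hZ : D.SatisfiesAC X Y Z) :
    D.GenBackdoorCriterion X Y (D.Desc X)ᶜ := by
  refine ⟨Set.compl_inter_self _, ?_⟩
  intro x hx y hy p hp ⟨b, l, hpb, hbx⟩
  by_contra hopen
  rcases hcond with hno | hYX
  · subst hpb
    cases l with
    | nil =>
      have hby : b = y := by simpa using hp.2.2.2
      subst hby
      have hbX : b ∉ X := fun h => Set.disjoint_left.1 hXY h hy
      rcases hZ.2 [x, b] ⟨⟨x, hx, b, hy, hp⟩, by simpa using hbX, fun h =>
          D.not_edge_of_edge hbx (List.isChain_cons_cons.1 h).1⟩ with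
        ⟨w, ⟨⟨c, d, h⟩, -⟩, -⟩ | ⟨w, ⟨c, d, h, -⟩, -⟩ <;>
      · have := h.length_le
        simp at this
    | cons c l =>
      have hnon : D.IsNonColliderOn (x :: b :: c :: l) b :=
        isNonColliderOn_of_triple hp.1 ⟨[], l, rfl⟩ fun h => D.not_edge_of_edge hbx h.1
      have hne : b ≠ x := by
        rintro rfl
        exact D.acyclic b (.single hbx)
      refine hno (D.exists_causal_between (b := b) (fun hbX => ?_) ?_ hx hbx)
      · exact hopen (.inl ⟨b, hnon, .inr hbX, hne⟩)
      · by_contra hbD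
        exact hopen (.inl ⟨b, hnon, .inl hbD, hne⟩)
  · have hgood : ∀ m y, m ∉ X → m ∈ D.Desc X → y ∈ Y → ReflTransGen (D.AvoidStep X) m y →
        m ∉ D.Anc X := fun m y => hZ.notMem_anc hZX
    obtain ⟨m, hmX, hmD, ⟨y', hy', hmy⟩, hm⟩ :=
      D.open_backdoor_suffix hXY hYX hgood hp hy hopen l [] x b hpb
    refine hgood m y' hmX hmD hy' hmy ⟨x, hx, ?_⟩
    rcases hm with rfl | ⟨hmb, -⟩
    · exact .single hbx
    · exact hmb.to_reflTransGen.tail hbx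

/-- Suppose `D` contains no directed path `⟨v₁, …, v_k⟩` with
`k ≥ 3`, `v₁ ∈ X`, `v_k ∈ X` and `v₂, …, v_{k-1} ∉ X`, or that `Y ⊆ De(X,D)`.  Then a
set disjoint from `X ∪ Y` satisfying the adjustment criterion relative to `(X, Y)`
exists iff a generalized back-door set relative to `(X, Y)` exists. -/
theorem ac_iff_generalized_backdoor
    (D : DAG V) (X Y : Set V)
    (hXY : Disjoint X Y) (hX : X.Nonempty) (hY : Y.Nonempty)
    (hcond : (¬ ∃ p x₁ x₂, x₁ ∈ X ∧ x₂ ∈ X ∧ D.IsPathFrom p x₁ x₂ ∧ D.IsCausal p ∧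
        3 ≤ p.length ∧ ∀ v ∈ p.tail.dropLast, v ∉ X) ∨ Y ⊆ D.Desc X) :
    (∃ Z, Disjoint Z (X ∪ Y) ∧ D.SatisfiesAC X Y Z) ↔
      (∃ Z, D.GenBackdoorCriterion X Y Z) := by
  constructor
  · rintro ⟨Z, hZd, hZ⟩
    exact ⟨_, D.genBackdoorCriterion_compl_desc hXY hcond
      (hZd.mono_right Set.subset_union_left) hZ⟩
  · rintro ⟨Z, hZ⟩
    refine ⟨Z \ Y, Set.disjoint_left.2 ?_, (hZ.diff hXY).satisfiesAC⟩
    rintro v ⟨hvZ, hvY⟩ (hvX | hvY')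
    · exact (hZ.1 ▸ ⟨hvZ, v, hvX, .refl⟩ : v ∈ (∅ : Set V))
    · exact hvY hvY'

end DAG
end

section
/- Let 𝐗 and 𝐘 be disjoint nonempty node sets in a DAG D, and let I be a node set with forb(𝐗,𝐘,D) ⊆ I and De(I,D) = I (I is descendral). If there is a proper non-causal path from 𝐗 to 𝐘 in D that is d-connecting given Adjust(𝐗,𝐘,D) \ I, then there is a path p from 𝐗 to 𝐘 in D such that: (i) p is a proper non-causal path from 𝐗 to 𝐘; (ii) every collider on p is in Adjust(𝐗,𝐘,D) \ I; and (iii) every non-collider on p is in I. -/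
attribute [local instance] Classical.propDecidable

namespace DAG

variable {V : Type} [Fintype V] [DecidableEq V]

theorem eq_and_eq_of_triple_infix {α : Type*} {p : List α} (hp : p.Nodup) {a b a' b' w : α}
    (h : [a, w, b] <:+: p) (h' : [a', w, b'] <:+: p) : a = a' ∧ b = b' := by
  obtain ⟨s, t, rfl⟩ := h
  obtain ⟨s', t', h'⟩ := h'
  have e : (s' ++ [a']) ++ w :: (b' :: t') = (s ++ [a]) ++ w :: (b :: t) := by simpa using h'
  have hnd : ((s ++ [a]) ++ w :: (b :: t)).Nodup := by simpa using hp
  have n₁ : w ∉ s ++ [a] := fun hw =>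
    (List.nodup_append.1 hnd).2.2 w hw w (by simp) rfl
  have n₂ : w ∉ b :: t := (List.nodup_cons.1 (List.nodup_append.1 hnd).2.1).1
  obtain ⟨e₁, -, e₂⟩ := (List.append_cons_inj_of_notMem n₁ n₂).1 e.symm
  simp at e₁ e₂
  exact ⟨e₁.2, e₂.1⟩

theorem IsColliderOn.of_infix {D : DAG V} {p q : List V} {w : V} (h : D.IsColliderOn q w)
    (hq : q <:+: p) : D.IsColliderOn p w := by
  obtain ⟨a, b, hi, ha, hb⟩ := h
  exact ⟨a, b, hi.trans hq, ha, hb⟩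

theorem IsNonColliderOn.of_infix {D : DAG V} {p q : List V} {w : V} (hp : p.Nodup)
    (h : D.IsNonColliderOn q w) (hq : q <:+: p) : D.IsNonColliderOn p w := by
  obtain ⟨⟨a, b, hi⟩, hn⟩ := h
  refine ⟨⟨a, b, hi.trans hq⟩, ?_⟩
  rintro ⟨a', b', hi', ha, hb⟩
  obtain ⟨rfl, rfl⟩ := eq_and_eq_of_triple_infix hp hi' (hi.trans hq)
  exact hn ⟨a', b', hi, ha, hb⟩

theorem Blocks.of_infix {D : DAG V} {Z : Set V} {p q : List V} (hp : p.Nodup)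
    (h : D.Blocks Z q) (hq : q <:+: p) : D.Blocks Z p := by
  rcases h with ⟨w, hw, hZ⟩ | ⟨w, hw, hZ⟩
  · exact Or.inl ⟨w, hw.of_infix hp hq, hZ⟩
  · exact Or.inr ⟨w, hw.of_infix hq, hZ⟩

theorem IsColliderOn.reverse {D : DAG V} {p : List V} {w : V} (h : D.IsColliderOn p.reverse w) :
    D.IsColliderOn p w := by
  obtain ⟨a, b, hi, ha, hb⟩ := h
  exact ⟨b, a, by simpa using List.reverse_infix.2 hi, hb, ha⟩

/-- On a path whose colliders and last node lie in an ancestral set, a node entered by a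
forward edge lies in that set. -/
theorem mem_of_forward_edge {D : DAG V} {A : Set V} (hA : ∀ a b, D.Edge a b → b ∈ A → a ∈ A)
    {p : List V} (hc : p.IsChain D.Adj) (hcol : ∀ w, D.IsColliderOn p w → w ∈ A)
    (hlast : ∀ y, p.getLast? = some y → y ∈ A) (r : List V) :
    ∀ a w, [a, w] ++ r <:+ p → D.Edge a w → w ∈ A := by
  induction r with
  | nil =>
    rintro a w ⟨l, rfl⟩ -
    exact hlast w (by simp)
  | cons b r ih =>
    intro a w hs haw
    have hadj : D.Adj w b := by
      have := hc.suffix hs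
      simp at this
      exact this.2.1
    rcases hadj with hwb | hbw
    · exact hA w b hwb (ih w b ((List.suffix_cons a _).trans hs) hwb)
    · refine hcol w ⟨a, b, ?_, haw, hbw⟩
      exact List.IsInfix.trans ⟨[], r, by simp⟩ hs.isInfix

/-- On a path whose colliders and endpoints lie in an ancestral set, every interior node lies in
that set. -/
theorem mem_of_triple_infix {D : DAG V} {A : Set V} (hA : ∀ a b, D.Edge a b → b ∈ A → a ∈ A)
    {p : List V} (hc : p.IsChain D.Adj) (hcol : ∀ w, D.IsColliderOn p w → w ∈ A)
    (hhead : ∀ x, p.head? = some x → x ∈ A) (hlast : ∀ y, p.getLast? = some y → y ∈ A)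
    {a w b : V} (h : [a, w, b] <:+: p) : w ∈ A := by
  obtain ⟨s, t, e⟩ := id h
  have hc' := hc.infix h
  simp at hc'
  rcases hc'.1 with haw | hwa
  · exact mem_of_forward_edge hA hc hcol hlast (b :: t) a w ⟨s, by simpa using e⟩ haw
  rcases hc'.2 with hwb | hbw
  · exact hA w b hwb
      (mem_of_forward_edge hA hc hcol hlast t w b ⟨s ++ [a], by simpa using e⟩ hwb)
  · have hcr : p.reverse.IsChain D.Adj := by
      rw [List.isChain_reverse]
      exact hc.imp fun _ _ h => h.symm
    refine mem_of_forward_edge hA hcr (fun w hw => hcol w hw.reverse)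
      (fun x hx => hhead x (by simpa using hx)) (a :: s.reverse) b w ⟨t.reverse, ?_⟩ hbw
    rw [← e]
    simp

/-- Let `I ⊇ forb(X,Y,D)` be descendral.  If some proper non-causal
path from `X` to `Y` in `D` is d-connecting given `Adjust(X,Y,D) \ I`, then there is a
proper non-causal path `p` from `X` to `Y` in `D` all of whose colliders are in
`Adjust(X,Y,D) \ I` and all of whose non-colliders are in `I`. -/
theorem general_path_lemma
    (D : DAG V) (X Y I : Set V)
    (hXY : Disjoint X Y) (hX : X.Nonempty) (hY : Y.Nonempty)
    (hforb : D.Forb X Y ⊆ I) (hdescendral : D.Desc I = I)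
    (hconn : ∃ p, D.ProperNonCausalPath X Y p ∧
      ¬ D.Blocks (D.AdjustSet X Y \ I) p) :
    ∃ p, D.ProperNonCausalPath X Y p ∧
      (∀ w, D.IsColliderOn p w → w ∈ D.AdjustSet X Y \ I) ∧
      (∀ w, D.IsNonColliderOn p w → w ∈ I) := by
  obtain ⟨p, ⟨hp, hblock⟩, hmin⟩ : ∃ p, (D.ProperNonCausalPath X Y p ∧
      ¬ D.Blocks (D.AdjustSet X Y \ I) p) ∧ ∀ q, (D.ProperNonCausalPath X Y q ∧
      ¬ D.Blocks (D.AdjustSet X Y \ I) q) → ¬ q.length < p.length := by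
    obtain ⟨p, hp, hmin⟩ := (measure (List.length (α := V))).wf.has_min
      {p | D.ProperNonCausalPath X Y p ∧ ¬ D.Blocks (D.AdjustSet X Y \ I) p} hconn
    exact ⟨p, hp, hmin⟩
  obtain ⟨⟨x, hx, y, hy, hnd, hchain, hhead, hlast⟩, hproper, hnc⟩ := id hp
  -- Every collider is an ancestor of the conditioning set.
  have hdesc : ∀ w, D.IsColliderOn p w →
      ∃ z ∈ D.AdjustSet X Y \ I, Relation.ReflTransGen D.Edge w z := by
    intro w hw
    by_contra! hcon
    refine hblock (Or.inr ⟨w, hw, ?_⟩)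
    ext z
    simp only [Set.mem_inter_iff, Set.mem_empty_iff_false, iff_false]
    rintro ⟨⟨w', rfl, hwz⟩, hz⟩
    exact hcon z hz hwz
  have hanc : ∀ a b w, [a, w, b] <:+: p → w ∈ D.Anc (X ∪ Y) := by
    intro a b w
    refine mem_of_triple_infix ?_ hchain ?_ ?_ ?_
    · rintro a b hab ⟨v, hv, hbv⟩
      exact ⟨v, hv, .head hab hbv⟩
    · intro w hw
      obtain ⟨z, ⟨⟨⟨v, hv, hzv⟩, -⟩, -⟩, hwz⟩ := hdesc w hw
      exact ⟨v, hv, hwz.trans hzv⟩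
    · intro v hv
      obtain rfl : x = v := by simpa [hhead] using hv
      exact ⟨x, Or.inl hx, .refl⟩
    · intro v hv
      obtain rfl : y = v := by simpa [hlast] using hv
      exact ⟨y, Or.inr hy, .refl⟩
  have hnX : ∀ a b w, [a, w, b] <:+: p → w ∉ X := by
    rintro a b w ⟨s, t, rfl⟩
    apply hproper
    cases s <;> simp
  -- An interior node in `Y \ I` would allow truncating the path.
  have hYI : ∀ a b w, [a, w, b] <:+: p → w ∈ Y → w ∈ I := by
    intro a b w h hwY
    by_contra hwI
    obtain ⟨s, t, e⟩ := h
    have hpre : s ++ [a, w] <+: p := ⟨b :: t, by simpa using e⟩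
    have hpath : D.IsPathFrom (s ++ [a, w]) x w := by
      refine ⟨hnd.sublist hpre.sublist, List.IsChain.prefix hchain hpre, ?_, by simp⟩
      rw [← hhead, ← e]
      cases s <;> simp
    have hprop : ∀ v ∈ (s ++ [a, w]).tail, v ∉ X := by
      intro v hv
      obtain ⟨r, hr⟩ := hpre
      refine hproper v ?_
      rw [← hr, List.tail_append_of_ne_nil (by simp)]
      exact List.mem_append_left r hv
    have hnc' : ¬ D.IsCausal (s ++ [a, w]) := fun hcaus =>
      hwI (hforb ⟨s ++ [a, w], w, ⟨⟨x, hx, w, hwY, hpath⟩, hprop, hcaus⟩, by simp,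
        fun hwX => Set.disjoint_left.1 hXY hwX hwY, .refl⟩)
    have := hmin (s ++ [a, w]) ⟨⟨⟨x, hx, w, hwY, hpath⟩, hprop, hnc'⟩,
      fun hb => hblock (hb.of_infix hnd hpre.isInfix)⟩
    rw [← e] at this
    simp at this
  refine ⟨p, hp, ?_, ?_⟩
  · intro w hw
    obtain ⟨a, b, hi, -, -⟩ := id hw
    have hwI : w ∉ I := by
      intro hwI
      obtain ⟨z, hz, hwz⟩ := hdesc w hw
      exact hz.2 (hdescendral ▸ ⟨w, hwI, hwz⟩)
    refine ⟨⟨hanc a b w hi, ?_⟩, hwI⟩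
    rintro ((h | h) | h)
    · exact hnX a b w hi h
    · exact hwI (hYI a b w hi h)
    · exact hwI (hforb h)
  · intro w hw
    obtain ⟨⟨a, b, hi⟩, -⟩ := id hw
    by_contra hwI
    refine hblock (Or.inl ⟨w, hw, ⟨hanc a b w hi, ?_⟩, hwI⟩)
    rintro ((h | h) | h)
    · exact hnX a b w hi h
    · exact hwI (hYI a b w hi h)
    · exact hwI (hforb h)

end DAG
end

section
/- Let 𝐗, 𝐘, Z₀ be pairwise disjoint node sets in a DAG D with 𝐗 and 𝐘 nonempty, such that Z₀ satisfies the adjustment criterion relative to (𝐗,𝐘) in D. Let Z₁ ⊆ An(𝐗 ∪ 𝐘, D) \ (De(𝐗,D) ∪ 𝐘) and Z = Z₀ ∪ Z₁. Then: (i) 𝐗, 𝐘 and Z are pairwise disjoint; (ii) Z satisfies the adjustment criterion relative to (𝐗,𝐘) in D; and (iii) for every strictly positive joint probability mass function f consistent with the causal DAG D and all assignments x, y: Σ_{z₀} f(y | x, z₀) f(z₀) = Σ_{z₀,z₁} f(y | x, z₀, z₁) f(z₀, z₁). -/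
attribute [local instance] Classical.propDecidable

namespace DAG

variable {V : Type} [Fintype V] [DecidableEq V]

section PMF

variable {A : Type} [Fintype A] [DecidableEq A]

/-- the marginal probability of the event `{w | w = v on S}` under the pmf `f` -/
noncomputable def marg (f : (V → A) → ℝ) (S : Set V) (v : V → A) : ℝ :=
  ∑ w : V → A, if ∀ i ∈ S, w i = v i then f w else 0

/-- the conditional probability `f(s | t)` of the values of `v` on `S` given those on `T` -/
noncomputable def condP (f : (V → A) → ℝ) (S T : Set V) (v : V → A) : ℝ :=
  marg f (S ∪ T) v / marg f T v

/-- the parents of a node -/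
def parents (D : DAG V) (i : V) : Set V := {j | D.Edge j i}

/-- `f` is a strictly positive joint pmf consistent with the causal DAG `D`:
it is positive, sums to one, and factorizes according to `D`. -/
def IsConsistent (D : DAG V) (f : (V → A) → ℝ) : Prop :=
  (∀ v, 0 < f v) ∧ (∑ v : V → A, f v = 1) ∧
  (∀ v, f v = ∏ i : V, condP f {i} (D.parents i) v)

/-- the interventional pmf `f(v | do(X = x))`, defined by truncated factorization -/
noncomputable def doPMF (D : DAG V) (f : (V → A) → ℝ) (X : Set V) (x : V → A)
    (v : V → A) : ℝ :=
  if ∀ i ∈ X, v i = x i then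
    ∏ i : V, if i ∈ X then 1 else condP f {i} (D.parents i) v
  else 0

/-- the adjustment formula `∑_z f(y | x, z) f(z)`, where the values of `X` and `Y`
are read off from the assignment `a` (coordinates outside `Z` are pinned to `a`) -/
noncomputable def adjFormula (f : (V → A) → ℝ) (X Y Z : Set V) (a : V → A) : ℝ :=
  ∑ w : V → A, if ∀ i, i ∉ Z → w i = a i then condP f Y (X ∪ Z) w * marg f Z w else 0

end PMF

end DAG



set_option linter.unusedSectionVars false

namespace DAG

variable {V : Type} [Fintype V] [DecidableEq V]

section Marginalization

variable {A : Type} [Fintype A] [DecidableEq A]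

/-- `sumOut T F` sums `F` over the coordinates in `T`. -/
noncomputable def sumOut (T : Set V) (F : (V → A) → ℝ) (v : V → A) : ℝ :=
  ∑ w : V → A, if ∀ i, i ∉ T → w i = v i then F w else 0

theorem sumOut_congr {T : Set V} {F G : (V → A) → ℝ} {v : V → A}
    (h : ∀ w, (∀ i, i ∉ T → w i = v i) → F w = G w) : sumOut T F v = sumOut T G v := by
  unfold sumOut
  refine Finset.sum_congr rfl fun w _ => ?_
  split_ifs with hw
  · exact h w hw
  · rfl

theorem sumOut_union {S T : Set V} (hST : Disjoint S T) (F : (V → A) → ℝ) :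
    sumOut (S ∪ T) F = sumOut S (sumOut T F) := by
  funext v
  unfold sumOut
  have hswap : ∀ w : V → A,
      (if ∀ i, i ∉ S → w i = v i then
        ∑ u : V → A, (if ∀ i, i ∉ T → u i = w i then F u else 0) else 0) =
      ∑ u : V → A, if (∀ i, i ∉ S → w i = v i) ∧ (∀ i, i ∉ T → u i = w i) then F u else 0 := by
    intro w
    by_cases hw : ∀ i, i ∉ S → w i = v i
    · rw [if_pos hw]
      exact Finset.sum_congr rfl fun u _ => if_congr (by tauto) rfl rfl
    · simp only [hw, false_and, if_false, Finset.sum_const_zero]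
  rw [Finset.sum_congr rfl fun w _ => hswap w, Finset.sum_comm]
  refine Finset.sum_congr rfl fun u _ => ?_
  have hiff : ∀ w : V → A, ((∀ i, i ∉ S → w i = v i) ∧ (∀ i, i ∉ T → u i = w i)) ↔
      (w = S.piecewise u v ∧ ∀ i, i ∉ S ∪ T → u i = v i) := by
    intro w
    constructor
    · rintro ⟨h1, h2⟩
      refine ⟨?_, fun i hi => ?_⟩
      · funext i
        by_cases hi : i ∈ S
        · simpa [hi] using (h2 i (Set.disjoint_left.1 hST hi)).symm
        · simpa [hi] using h1 i hi
      · rw [Set.mem_union, not_or] at hi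
        rw [h2 i hi.2, h1 i hi.1]
    · rintro ⟨rfl, h⟩
      refine ⟨fun i hi => by simp [hi], fun i hi => ?_⟩
      by_cases hS : i ∈ S
      · simp [hS]
      · simpa [hS] using h i (by simp [hS, hi])
  by_cases h : ∀ i, i ∉ S ∪ T → u i = v i
  · simp only [hiff, eq_true h, and_true, Finset.sum_ite_eq', Finset.mem_univ,
      if_true]
  · simp only [hiff, eq_false h, and_false, if_false, Finset.sum_const_zero]

theorem sumOut_mul_left {T S : Set V} {φ : (V → A) → ℝ} (hφ : DependsOn φ S)
    (hST : Disjoint S T) (F : (V → A) → ℝ) : sumOut T (φ * F) = φ * sumOut T F := by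
  funext v
  simp only [sumOut, Pi.mul_apply, Finset.mul_sum]
  refine Finset.sum_congr rfl fun w _ => ?_
  split_ifs with hw
  · rw [hφ fun i hi => hw i (Set.disjoint_left.1 hST hi)]
  · simp

theorem sumOut_mul_right {T S : Set V} {φ : (V → A) → ℝ} (hφ : DependsOn φ S)
    (hST : Disjoint S T) (F : (V → A) → ℝ) : sumOut T (F * φ) = sumOut T F * φ := by
  rw [mul_comm, sumOut_mul_left hφ hST, mul_comm]

theorem dependsOn_sumOut {T S : Set V} {F : (V → A) → ℝ} (hF : DependsOn F S) :
    DependsOn (sumOut T F) S := by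
  intro v v' hv
  simp only [sumOut, ← Finset.sum_filter]
  refine Finset.sum_bij' (fun w _ => T.piecewise w v') (fun w _ => T.piecewise w v) ?_ ?_ ?_ ?_ ?_
  · intro w _
    simp +contextual
  · intro w _
    simp +contextual
  · intro w hw
    simp only [Finset.mem_filter, Finset.mem_univ, true_and] at hw
    funext i
    by_cases hi : i ∈ T
    · simp [hi]
    · simp [hi, hw i hi]
  · intro w hw
    simp only [Finset.mem_filter, Finset.mem_univ, true_and] at hw
    funext i
    by_cases hi : i ∈ T
    · simp [hi]
    · simp [hi, hw i hi]
  · intro w hw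
    simp only [Finset.mem_filter, Finset.mem_univ, true_and] at hw
    refine hF fun i hi => ?_
    by_cases hT : i ∈ T
    · simp [hT]
    · simp [hT, hw i hT, hv i hi]

theorem marg_eq_sumOut (f : (V → A) → ℝ) (S : Set V) : marg f S = sumOut Sᶜ f := by
  funext v
  simp only [marg, sumOut, Set.mem_compl_iff, not_not]

theorem dependsOn_mul {S : Set V} {F G : (V → A) → ℝ} (hF : DependsOn F S)
    (hG : DependsOn G S) : DependsOn (F * G) S := fun x y h => by
  simp only [Pi.mul_apply, hF h, hG h]

theorem dependsOn_marg (f : (V → A) → ℝ) (S : Set V) : DependsOn (marg f S) S := by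
  intro v v' hv
  unfold marg
  refine Finset.sum_congr rfl fun w _ => ?_
  have : (∀ i ∈ S, w i = v i) ↔ ∀ i ∈ S, w i = v' i :=
    forall₂_congr fun i hi => by rw [hv i hi]
  simp only [this]

theorem dependsOn_condP (f : (V → A) → ℝ) (S T : Set V) : DependsOn (condP f S T) (S ∪ T) := by
  intro v v' hv
  unfold condP
  rw [dependsOn_marg f _ hv, dependsOn_marg f T fun i hi => hv i (Or.inr hi)]

theorem marg_pos {f : (V → A) → ℝ} (hf : ∀ v, 0 < f v) (S : Set V) (v : V → A) :
    0 < marg f S v := by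
  unfold marg
  refine Finset.sum_pos' (fun w _ => ?_) ⟨v, Finset.mem_univ _, ?_⟩
  · split_ifs
    exacts [(hf w).le, le_rfl]
  · simpa using hf v

theorem sumOut_condP {f : (V → A) → ℝ} (hf : ∀ v, 0 < f v) {S T : Set V} (hST : Disjoint S T) :
    sumOut S (condP f S T) = 1 := by
  have h1 : condP f S T = marg f (S ∪ T) * (marg f T)⁻¹ := by
    funext v
    simp [condP, div_eq_mul_inv]
  have h2 : DependsOn (marg f T)⁻¹ T := fun x y h => by
    simp only [Pi.inv_apply, dependsOn_marg f T h]
  rw [h1, sumOut_mul_right h2 hST.symm, marg_eq_sumOut f (S ∪ T), ← sumOut_union]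
  · have : S ∪ (S ∪ T)ᶜ = Tᶜ := by
      ext i
      have : i ∈ S → i ∉ T := fun h => Set.disjoint_left.1 hST h
      simp only [Set.mem_union, Set.mem_compl_iff]
      tauto
    rw [this, ← marg_eq_sumOut]
    funext v
    exact mul_inv_cancel₀ (marg_pos hf T v).ne'
  · exact Set.disjoint_compl_right_iff_subset.2 Set.subset_union_left

/-- The product of the factors `k i` with `i ∈ S`. -/
noncomputable def prodOn (S : Set V) (k : V → (V → A) → ℝ) : (V → A) → ℝ :=
  fun w => ∏ i : V, if i ∈ S then k i w else 1

theorem prodOn_union {S T : Set V} (hST : Disjoint S T) (k : V → (V → A) → ℝ) :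
    prodOn (S ∪ T) k = prodOn S k * prodOn T k := by
  funext w
  simp only [prodOn, Pi.mul_apply, ← Finset.prod_mul_distrib]
  refine Finset.prod_congr rfl fun i _ => ?_
  have : i ∈ S → i ∉ T := fun h => Set.disjoint_left.1 hST h
  by_cases h1 : i ∈ S <;> by_cases h2 : i ∈ T <;> simp_all

theorem prodOn_congr {S : Set V} {k k' : V → (V → A) → ℝ} (h : ∀ i ∈ S, k i = k' i) :
    prodOn S k = prodOn S k' := by
  funext w
  refine Finset.prod_congr rfl fun i _ => ?_
  split_ifs with hi
  · rw [h i hi]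
  · rfl

theorem dependsOn_prodOn {S T : Set V} {k : V → (V → A) → ℝ}
    (h : ∀ i ∈ S, DependsOn (k i) T) : DependsOn (prodOn S k) T := by
  intro v v' hv
  refine Finset.prod_congr rfl fun i _ => ?_
  split_ifs with hi
  · exact h i hi hv
  · rfl

theorem prodOn_singleton (i : V) (k : V → (V → A) → ℝ) : prodOn {i} k = k i := by
  funext w
  simp [prodOn]

theorem prodOn_empty (k : V → (V → A) → ℝ) : prodOn ∅ k = 1 := by
  funext w
  simp [prodOn]

theorem exists_source (D : DAG V) {T : Set V} (hT : T.Nonempty) :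
    ∃ i ∈ T, ∀ j ∈ T, ¬ D.Edge j i := by
  have : Std.Irrefl (Relation.TransGen D.Edge) := ⟨D.acyclic⟩
  obtain ⟨i, hi, hmin⟩ :=
    (Finite.wellFounded_of_trans_of_irrefl (Relation.TransGen D.Edge)).has_min T hT
  exact ⟨i, hi, fun j hj h => hmin j hj (.single h)⟩

theorem sumOut_empty (F : (V → A) → ℝ) : sumOut ∅ F = F := by
  funext v
  simp [sumOut, ← funext_iff]

theorem sumOut_prodOn_condP (D : DAG V) {f : (V → A) → ℝ} (hf : ∀ v, 0 < f v) (T : Set V) :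
    sumOut T (prodOn T fun i => condP f {i} (D.parents i)) = 1 := by
  induction hn : T.ncard using Nat.strong_induction_on generalizing T with
  | _ n ih =>
    rcases T.eq_empty_or_nonempty with rfl | hT
    · rw [prodOn_empty, sumOut_empty]
    obtain ⟨i, hi, hsrc⟩ := D.exists_source hT
    have hTi : {i} ∪ T \ {i} = T := by
      rw [Set.union_sdiff_self]
      exact Set.union_eq_right.2 (Set.singleton_subset_iff.2 hi)
    have hdisj : Disjoint {i} (T \ {i}) := Set.disjoint_sdiff_right
    have hlt : (T \ {i}).ncard < n := hn ▸ Set.ncard_sdiff_singleton_lt_of_mem hi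
    have hpar : Disjoint ({i} ∪ D.parents i) (T \ {i}) := by
      rw [Set.disjoint_union_left]
      exact ⟨hdisj, Set.disjoint_left.2 fun j hj hjT => hsrc j hjT.1 hj⟩
    have hself : Disjoint {i} (D.parents i) :=
      Set.disjoint_singleton_left.2 fun h => D.acyclic i (.single h)
    rw [← hTi, prodOn_union hdisj, prodOn_singleton, sumOut_union hdisj,
      sumOut_mul_left (dependsOn_condP f {i} (D.parents i)) hpar,
      ih _ hlt _ rfl, mul_one, sumOut_condP hf hself]

theorem sumOut_mul_prodOn_condP (D : DAG V) {f φ : (V → A) → ℝ} (hf : ∀ v, 0 < f v)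
    {S T : Set V} (hφ : DependsOn φ S) (hST : Disjoint S T) :
    sumOut T (φ * prodOn T fun i => condP f {i} (D.parents i)) = φ := by
  rw [sumOut_mul_left hφ hST, sumOut_prodOn_condP D hf, mul_one]

end Marginalization

end DAG

namespace DAG

variable {V : Type} [Fintype V] [DecidableEq V]

/-- The nodes entered by the first edge of some proper causal path from `X` to `Y`. -/
def firstMediators (D : DAG V) (X Y : Set V) : Set V :=
  {w | w ∉ X ∧ (∃ x ∈ X, D.Edge x w) ∧
    ∃ y ∈ Y, Relation.ReflTransGen (fun a b => D.Edge a b ∧ b ∉ X) w y}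

/-- The proper back-door graph: the first edges of all proper causal paths from `X` to `Y`
are removed. -/
def properBackdoor (D : DAG V) (X Y : Set V) : DAG V where
  Edge a b := D.Edge a b ∧ ¬ (a ∈ X ∧ b ∈ D.firstMediators X Y)
  acyclic v h := D.acyclic v (h.lift id fun _ _ h => h.1)

/-- `P` is a side, containing `X` but not meeting `Y`, of a partition showing that `Z` separates
`X` from `Y` in the moral graph of the ancestors of `X ∪ Y ∪ Z` in the proper back-door graph. -/
structure IsMoralSide (D : DAG V) (X Y Z P : Set V) : Prop where
  subset_anc : P ⊆ D.Anc (X ∪ Y ∪ Z)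
  disjoint_sep : Disjoint P Z
  source_subset : X ⊆ P
  disjoint_target : Disjoint P Y
  closed : ∀ i ∈ D.Anc (X ∪ Y ∪ Z), ∀ u v, (u = i ∨ (D.properBackdoor X Y).Edge u i) →
    (v = i ∨ (D.properBackdoor X Y).Edge v i) → u ∉ Z → v ∉ Z → u ∈ P → v ∈ P

theorem subset_anc (D : DAG V) (S : Set V) : S ⊆ D.Anc S := fun _ h => ⟨_, h, .refl⟩

theorem anc_of_edge {D : DAG V} {S : Set V} {u v : V} (h : D.Edge u v) (hv : v ∈ D.Anc S) :
    u ∈ D.Anc S := by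
  obtain ⟨s, hs, hvs⟩ := hv
  exact ⟨s, hs, .head h hvs⟩

theorem anc_mono (D : DAG V) {S T : Set V} (h : S ⊆ T) : D.Anc S ⊆ D.Anc T :=
  fun _ ⟨s, hs, hvs⟩ => ⟨s, h hs, hvs⟩

theorem desc_of_edge {D : DAG V} {S : Set V} {u v : V} (h : D.Edge u v) (hu : u ∈ D.Desc S) :
    v ∈ D.Desc S := by
  obtain ⟨s, hs, hsu⟩ := hu
  exact ⟨s, hs, hsu.tail h⟩

theorem IsMoralSide.mem_anc_and_notMem_of_mem_firstMediators {D : DAG V} {X Y Z P : Set V}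
    (h : D.IsMoralSide X Y Z P) (hF : Disjoint (D.Desc (D.firstMediators X Y)) Z)
    {w : V} (hw : w ∈ D.firstMediators X Y) :
    w ∈ D.Anc (X ∪ Y ∪ Z) ∧ w ∉ P := by
  obtain ⟨hwX, -, y, hy, hwy⟩ := id hw
  have hwD : w ∈ D.Desc (D.firstMediators X Y) := ⟨w, hw, .refl⟩
  clear hw
  induction hwy using Relation.ReflTransGen.head_induction_on with
  | refl => exact ⟨D.subset_anc _ (by simp [hy]), fun hP => Set.disjoint_left.1 h.disjoint_target hP hy⟩
  | @head a c hac _ ih =>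
    have hcD := desc_of_edge hac.1 hwD
    obtain ⟨hcA, hcP⟩ := ih hac.2 hcD
    refine ⟨anc_of_edge hac.1 hcA, fun haP => hcP ?_⟩
    exact h.closed c hcA a c (.inr ⟨hac.1, fun h => hwX h.1⟩) (.inl rfl)
      (Set.disjoint_left.1 hF hwD) (Set.disjoint_left.1 hF hcD) haP

theorem IsMoralSide.notMem_of_mem_desc_firstMediators {D : DAG V} {X Y Z P : Set V}
    (h : D.IsMoralSide X Y Z P) (hF : Disjoint (D.Desc (D.firstMediators X Y)) Z)
    {v : V} (hv : v ∈ D.Desc (D.firstMediators X Y))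
    (hvA : v ∈ D.Anc (X ∪ Y ∪ Z)) : v ∉ P := by
  obtain ⟨w, hw, hwv⟩ := hv
  induction hwv with
  | refl => exact (h.mem_anc_and_notMem_of_mem_firstMediators hF hw).2
  | @tail b c hwb hbc ih =>
    have hbP := ih (anc_of_edge hbc hvA)
    have hb : b ∉ Z := Set.disjoint_left.1 hF ⟨w, hw, hwb⟩
    have hc : c ∉ Z := Set.disjoint_left.1 hF ⟨w, hw, hwb.tail hbc⟩
    exact fun hcP => hbP <| h.closed c hvA c b (.inl rfl)
      (.inr ⟨hbc, fun h' => hbP (h.source_subset h'.1)⟩) hc hb hcP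

section Formula

variable {A : Type} [Fintype A] [DecidableEq A]

/-- If the marginal of `f` on `P ∪ Q ∪ Z` factorizes as `g * q` with `g` a function of `P ∪ Z` and
`q` a function of `Q ∪ Z ∪ X`, whose sum over `Q` does not depend on `X`, then adjusting for `Z`
amounts to pinning the argument `X` of `q` to `a`. -/
theorem adjFormula_eq_sumOut_of_factorization {X Y Z P Q : Set V} (hPZ : Disjoint P Z)
    (hQZ : Disjoint Q Z) (hPQ : Disjoint P Q) (hXP : X ⊆ P) (hYQ : Y ⊆ Q)
    {f f' g q q' : (V → A) → ℝ} (hf : ∀ v, 0 < f v) {a : V → A}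
    (hfN : sumOut (P ∪ Q ∪ Z)ᶜ f = g * q) (hf'N : sumOut (P ∪ Q ∪ Z)ᶜ f' = g * q')
    (hg : DependsOn g (P ∪ Z)) (hq : DependsOn q (Q ∪ Z ∪ X)) (hq' : DependsOn q' (Q ∪ Z))
    (hK : DependsOn (sumOut Q q) (Q ∪ Z)) (hq'q : ∀ w, q' w = q (X.piecewise a w)) :
    adjFormula f X Y Z a = sumOut Yᶜ f' a := by
  set N := (P ∪ Q ∪ Z)ᶜ with hN
  set K := sumOut Q q with hKdef
  set H := sumOut (Q \ Y) q with hH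
  set g₁ := sumOut (P \ X) g with hg₁
  set g₂ := sumOut P g with hg₂
  have hHdep : DependsOn H (Q ∪ Z ∪ X) := dependsOn_sumOut hq
  have hH'dep : DependsOn (sumOut (Q \ Y) q') (Q ∪ Z) := dependsOn_sumOut hq'
  rw [Set.disjoint_left] at hPZ hQZ hPQ
  have hNmem : ∀ i, i ∈ N ↔ i ∉ P ∧ i ∉ Q ∧ i ∉ Z := fun i => by simp [hN, and_assoc]
  clear_value N
  have hm1 : marg f (Y ∪ (X ∪ Z)) = g₁ * H := by
    have hset : (Y ∪ (X ∪ Z))ᶜ = P \ X ∪ (Q \ Y ∪ N) := by grind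
    rw [marg_eq_sumOut, hset, sumOut_union, sumOut_union, hfN, sumOut_mul_left hg,
      sumOut_mul_right hHdep]
    all_goals
      refine Set.disjoint_left.2 fun i h1 h2 => ?_
      grind
  have hm2 : marg f (X ∪ Z) = g₁ * K := by
    have hset : (X ∪ Z)ᶜ = P \ X ∪ (Q ∪ N) := by grind
    rw [marg_eq_sumOut, hset, sumOut_union, sumOut_union, hfN, sumOut_mul_left hg,
      sumOut_mul_right hK]
    all_goals
      refine Set.disjoint_left.2 fun i h1 h2 => ?_
      grind
  have hm3 : marg f Z = g₂ * K := by
    have hset : Zᶜ = P ∪ (Q ∪ N) := by grind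
    rw [marg_eq_sumOut, hset, sumOut_union, sumOut_union, hfN, sumOut_mul_left hg,
      sumOut_mul_right hK]
    all_goals
      refine Set.disjoint_left.2 fun i h1 h2 => ?_
      grind
  have hsummand : ∀ w, condP f Y (X ∪ Z) w * marg f Z w = (g₂ * H) w := by
    intro w
    have hpos := (marg_pos hf (X ∪ Z) w).ne'
    rw [condP, hm1, hm3]
    rw [hm2] at hpos ⊢
    simp only [Pi.mul_apply] at hpos ⊢
    have := left_ne_zero_of_mul hpos
    have := right_ne_zero_of_mul hpos
    field_simp
  have hlhs : adjFormula f X Y Z a = sumOut Z (g₂ * H) a := by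
    simp only [adjFormula, sumOut, hsummand]
  have hset : Yᶜ = Z ∪ (P ∪ (Q \ Y ∪ N)) := by grind
  rw [hlhs, hset, sumOut_union, sumOut_union, sumOut_union, hf'N, sumOut_mul_left hg,
    sumOut_mul_right hH'dep]
  · refine sumOut_congr fun w hw => ?_
    simp only [Pi.mul_apply]
    congr 1
    refine sumOut_congr fun u hu => ?_
    rw [hq'q]
    congr 1
    funext i
    by_cases hi : i ∈ X
    · have h1 : i ∉ Q \ Y := fun h' => hPQ (hXP hi) h'.1
      rw [hu i h1, hw i (hPZ (hXP hi))]
      simp [hi]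
    · simp [hi]
  all_goals
    refine Set.disjoint_left.2 fun i h1 h2 => ?_
    grind

/-- The causal mechanisms of `f`, with the values of `X` pinned to `a` as seen by the first nodes
of the proper causal paths from `X` to `Y`. -/
noncomputable def pinnedFactor (D : DAG V) (f : (V → A) → ℝ) (X Y : Set V) (a : V → A) (i : V)
    (w : V → A) : ℝ :=
  condP f {i} (D.parents i) (if i ∈ D.firstMediators X Y then X.piecewise a w else w)

theorem IsMoralSide.adjFormula_eq {D : DAG V} {X Y Z P : Set V} (h : D.IsMoralSide X Y Z P)
    (hF : Disjoint (D.Desc (D.firstMediators X Y)) Z) (hYZ : Disjoint Y Z)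
    {f : (V → A) → ℝ} (hf : D.IsConsistent f) (a : V → A) :
    adjFormula f X Y Z a = sumOut Yᶜ (prodOn Set.univ (D.pinnedFactor f X Y a)) a := by
  set B := D.Anc (X ∪ Y ∪ Z) with hB
  set M := D.firstMediators X Y with hM
  set G := D.properBackdoor X Y with hG
  set Q := (B \ Z) \ P with hQ
  set c : V → (V → A) → ℝ := fun i => condP f {i} (D.parents i) with hc
  have hZB : Z ⊆ B := Set.subset_union_right.trans (D.subset_anc _)
  have hPZ := Set.disjoint_left.1 h.disjoint_sep
  have hYQ : Y ⊆ Q := fun i hi =>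
    ⟨⟨D.subset_anc _ (.inl (.inr hi)), Set.disjoint_left.1 hYZ hi⟩,
      Set.disjoint_right.1 h.disjoint_target hi⟩
  have hQP : ∀ i ∈ Q, i ∉ P := fun i hi => hi.2
  have hQZ : ∀ i ∈ Q, i ∉ Z := fun i hi => hi.1.2
  have hBeq : P ∪ Q ∪ Z = B := by
    have := h.subset_anc
    grind
  set IP := {i ∈ B | ∀ u, (u = i ∨ G.Edge u i) → u ∈ P ∪ Z} with hIP
  set IQ := B \ IP with hIQ
  set F := D.Desc M ∩ B with hFdef
  have hMB : ∀ i ∈ M, i ∈ B := fun i hi => (h.mem_anc_and_notMem_of_mem_firstMediators hF hi).1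
  have hMF : ∀ i ∈ M, i ∈ F := fun i hi => ⟨⟨i, hi, .refl⟩, hMB i hi⟩
  have hFQ : F ⊆ Q := fun i hi =>
    ⟨⟨hi.2, Set.disjoint_left.1 hF hi.1⟩, h.notMem_of_mem_desc_firstMediators hF hi.1 hi.2⟩
  have hFIQ : F ⊆ IQ := fun i hi => ⟨hi.2, fun hi' =>
    (hi'.2 i (.inl rfl)).elim (hQP i (hFQ hi)) (hQZ i (hFQ hi))⟩
  have hedge : ∀ i, i ∉ M → ∀ u, u ∈ ({i} ∪ D.parents i : Set V) → (u = i ∨ G.Edge u i) := by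
    rintro i hi u (hu | hu)
    · exact .inl hu
    · exact .inr ⟨hu, fun h' => hi h'.2⟩
  have hanc : ∀ i ∈ B, ∀ u, u ∈ ({i} ∪ D.parents i : Set V) → u ∈ B := by
    rintro i hi u (hu | hu)
    · exact (Set.mem_singleton_iff.1 hu) ▸ hi
    · exact anc_of_edge hu hi
  have hIPdep : ∀ i ∈ IP, DependsOn (c i) (P ∪ Z) := fun i hi =>
    (dependsOn_condP f {i} (D.parents i)).mono fun u hu =>
      hi.2 u (hedge i (fun hiM => (hFIQ (hMF i hiM)).2 hi) u hu)
  have hIQfam : ∀ i ∈ IQ, ∀ u, (u = i ∨ G.Edge u i) → u ∈ B → u ∈ Q ∪ Z := by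
    rintro i ⟨hiB, hi⟩ u hu huB
    have : ∃ v, (v = i ∨ G.Edge v i) ∧ v ∉ P ∪ Z := by
      by_contra! hcon
      exact hi ⟨hiB, hcon⟩
    obtain ⟨v, hv, hvPZ⟩ := this
    rw [Set.mem_union, not_or] at hvPZ
    by_cases huZ : u ∈ Z
    · exact .inr huZ
    · exact .inl ⟨⟨huB, huZ⟩, fun huP => hvPZ.1 (h.closed i hiB u v hu hv huZ hvPZ.2 huP)⟩
  have hIQdep : ∀ i ∈ IQ, i ∉ M → DependsOn (c i) (Q ∪ Z) := fun i hi hiM =>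
    (dependsOn_condP f {i} (D.parents i)).mono fun u hu =>
      hIQfam i hi u (hedge i hiM u hu) (hanc i hi.1 u hu)
  have hIQdep' : ∀ i ∈ IQ, DependsOn (c i) (Q ∪ Z ∪ X) := fun i hi =>
    (dependsOn_condP f {i} (D.parents i)).mono fun u hu => by
      by_cases huX : u ∈ X
      · exact .inr huX
      · refine .inl (hIQfam i hi u ?_ (hanc i hi.1 u hu))
        rcases hu with hu | hu
        · exact .inl hu
        · exact .inr ⟨hu, fun h' => huX h'.1⟩
  have hgdep : DependsOn (prodOn IP c) (P ∪ Z) := dependsOn_prodOn hIPdep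
  have hqdep : DependsOn (prodOn IQ c) (Q ∪ Z ∪ X) := dependsOn_prodOn hIQdep'
  have hpin : ∀ i, i ∉ M → D.pinnedFactor f X Y a i = c i := fun i hi => by
    funext w
    simp only [pinnedFactor, hc]
    rw [if_neg hi]
  have hq'q : ∀ w, prodOn IQ (D.pinnedFactor f X Y a) w = prodOn IQ c (X.piecewise a w) := by
    intro w
    refine Finset.prod_congr rfl fun i _ => ?_
    split_ifs with hi
    · by_cases hiM : i ∈ M
      · simp only [pinnedFactor, hc]
        rw [if_pos hiM]
      · rw [hpin i hiM]
        refine hIQdep i hi hiM fun u hu => ?_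
        have : u ∉ X := fun huX =>
          hu.elim (fun hu => hQP u hu (h.source_subset huX)) (hPZ (h.source_subset huX))
        simp [this]
    · rfl
  have hq'dep : DependsOn (prodOn IQ (D.pinnedFactor f X Y a)) (Q ∪ Z) := by
    intro v v' hv
    rw [hq'q, hq'q]
    refine hqdep fun i hi => ?_
    by_cases hiX : i ∈ X
    · simp [hiX]
    · simpa [hiX] using hv i (hi.resolve_right hiX)
  have hsplit : ∀ k : V → (V → A) → ℝ,
      prodOn Set.univ k = prodOn IP k * prodOn IQ k * prodOn Bᶜ k := by
    intro k
    have hIPB : IP ∪ IQ = B := Set.union_sdiff_cancel fun i hi => hi.1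
    rw [← prodOn_union Set.disjoint_sdiff_right, hIPB, ← prodOn_union disjoint_compl_right,
      Set.union_compl_self]
  have hNB : Disjoint B Bᶜ := disjoint_compl_right
  have hPZB : P ∪ Z ⊆ B := Set.union_subset h.subset_anc hZB
  have hQZB : Q ∪ Z ⊆ B := Set.union_subset (fun i hi => hi.1.1) hZB
  have hQZXB : Q ∪ Z ∪ X ⊆ B := Set.union_subset hQZB (h.source_subset.trans h.subset_anc)
  have hK : DependsOn (sumOut Q (prodOn IQ c)) (Q ∪ Z) := by
    have h1 : ∀ i ∈ IQ \ F, DependsOn (c i) ((Q ∪ Z) \ F) := by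
      rintro i ⟨hi, hiF⟩ v v' hv
      refine dependsOn_condP f {i} (D.parents i) fun u hu => hv u ?_
      have hiM : i ∉ M := fun hiM => hiF (hMF i hiM)
      refine ⟨hIQfam i hi u (hedge i hiM u hu) (hanc i hi.1 u hu), fun huF => hiF ?_⟩
      rcases hu with hu | hu
      · exact (Set.mem_singleton_iff.1 hu) ▸ huF
      · exact ⟨desc_of_edge hu huF.1, hi.1⟩
    have h2 : DependsOn (prodOn (IQ \ F) c) ((Q ∪ Z) \ F) := dependsOn_prodOn h1
    have h3 : sumOut Q (prodOn IQ c) = sumOut (Q \ F) (prodOn (IQ \ F) c) := by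
      rw [← Set.sdiff_union_of_subset hFIQ, prodOn_union Set.disjoint_sdiff_left,
        Set.sdiff_union_of_subset hFIQ]
      conv_lhs => rw [← Set.sdiff_union_of_subset hFQ]
      rw [sumOut_union Set.disjoint_sdiff_left]
      congr 1
      exact sumOut_mul_prodOn_condP D hf.1 h2 Set.disjoint_sdiff_left
    rw [h3]
    exact dependsOn_sumOut (h2.mono Set.sdiff_subset)
  refine adjFormula_eq_sumOut_of_factorization h.disjoint_sep (Set.disjoint_left.2 hQZ)
    (Set.disjoint_right.2 hQP) h.source_subset hYQ hf.1 ?_ ?_ hgdep hqdep hq'dep hK hq'q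
  · have : f = prodOn Set.univ c := by
      funext v
      rw [hf.2.2 v]
      simp [prodOn, hc]
    rw [hBeq]
    conv_lhs => rw [this, hsplit]
    exact sumOut_mul_prodOn_condP D hf.1
      (dependsOn_mul (hgdep.mono hPZB) (hqdep.mono hQZXB)) hNB
  · rw [hBeq, hsplit, prodOn_congr (k' := c) fun i (hi : i ∈ Bᶜ) => hpin i fun hiM => hi (hMB i hiM),
      prodOn_congr (k' := c) fun i (hi : i ∈ IP) => hpin i fun hiM => (hFIQ (hMF i hiM)).2 hi]
    exact sumOut_mul_prodOn_condP D hf.1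
      (dependsOn_mul (hgdep.mono hPZB) (hq'dep.mono hQZB)) hNB

end Formula

end DAG

namespace DAG

variable {V : Type} [Fintype V] [DecidableEq V]

/-- A walk in `G` all of whose colliders lie in `S` and all of whose inner non-colliders avoid
`Z`. -/
def IsOpenWalk (G : DAG V) (S Z : Set V) (l : List V) : Prop :=
  l.IsChain G.Adj ∧ ∀ a w b, [a, w, b] <:+: l →
    (G.Edge a w ∧ G.Edge b w → w ∈ S) ∧ (¬ (G.Edge a w ∧ G.Edge b w) → w ∉ Z)

theorem not_edge_symm (G : DAG V) {a b : V} (h : G.Edge a b) : ¬ G.Edge b a :=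
  fun h' => G.acyclic a (.head h (.single h'))

theorem isOpenWalk_singleton (G : DAG V) (S Z : Set V) (v : V) : G.IsOpenWalk S Z [v] := by
  refine ⟨by simp, fun a w b h => ?_⟩
  have := h.length_le
  simp at this

theorem IsOpenWalk.of_isInfix {G : DAG V} {S Z : Set V} {l l' : List V} (h : G.IsOpenWalk S Z l)
    (hl : l' <:+: l) : G.IsOpenWalk S Z l' :=
  ⟨h.1.infix hl, fun a w b hi => h.2 a w b (hi.trans hl)⟩

theorem IsOpenWalk.tail {G : DAG V} {S Z : Set V} {u : V} {l : List V}
    (h : G.IsOpenWalk S Z (u :: l)) : G.IsOpenWalk S Z l :=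
  h.of_isInfix (List.suffix_cons u l).isInfix

theorem IsOpenWalk.cons {G : DAG V} {S Z : Set V} {u v : V} {l : List V}
    (h : G.IsOpenWalk S Z (v :: l)) (hadj : G.Adj u v)
    (hv : ∀ b ∈ l.head?, (G.Edge u v ∧ G.Edge b v → v ∈ S) ∧ (¬ (G.Edge u v ∧ G.Edge b v) → v ∉ Z)) :
    G.IsOpenWalk S Z (u :: v :: l) := by
  refine ⟨List.isChain_cons_cons.2 ⟨hadj, h.1⟩, fun a w b hi => ?_⟩
  rcases List.infix_cons_iff.1 hi with hi | hi
  · rw [List.cons_prefix_cons, List.cons_prefix_cons] at hi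
    obtain ⟨rfl, rfl, t, rfl⟩ := hi
    exact hv b (by simp)
  · exact h.2 a w b hi

theorem IsOpenWalk.triple {G : DAG V} {S Z : Set V} {a w b : V} {l : List V}
    (h : G.IsOpenWalk S Z (a :: w :: b :: l)) :
    (G.Edge a w ∧ G.Edge b w → w ∈ S) ∧ (¬ (G.Edge a w ∧ G.Edge b w) → w ∉ Z) :=
  h.2 a w b (List.IsPrefix.isInfix (by simp))

/-- An open walk starting with `u → v` is directed, unless `u` is an ancestor of a collider. -/
theorem IsOpenWalk.mem_or_isChain {G : DAG V} {S Z : Set V}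
    (hS : ∀ a b, G.Edge a b → b ∈ S → a ∈ S) {u v : V} {l : List V}
    (h : G.IsOpenWalk S Z (u :: v :: l)) (huv : G.Edge u v) :
    v ∈ S ∨ (u :: v :: l).IsChain G.Edge := by
  induction l generalizing u v with
  | nil => exact .inr (by simpa using huv)
  | cons b l ih =>
    by_cases hbv : G.Edge b v
    · exact .inl (h.triple.1 ⟨huv, hbv⟩)
    · have hvb : G.Edge v b := by
        have := (List.isChain_cons_cons.1 (List.isChain_cons_cons.1 h.1).2).1
        exact this.resolve_right hbv
      rcases ih h.tail hvb with hb | hb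
      · exact .inl (hS v b hvb hb)
      · exact .inr (List.isChain_cons_cons.2 ⟨huv, hb⟩)

theorem infix_append_cons {a w b c : V} {l₁ l₃ : List V} (h : [a, w, b] <:+: l₁ ++ c :: l₃) :
    [a, w, b] <:+: l₁ ++ [c] ∨ [a, w, b] <:+: c :: l₃ ∨
      w = c ∧ (∃ l₁', l₁ = l₁' ++ [a]) ∧ ∃ l₃', l₃ = b :: l₃' := by
  induction l₁ with
  | nil => exact .inr (.inl h)
  | cons d l₁ ih =>
    rw [List.cons_append, List.infix_cons_iff] at h
    rcases h with h | h
    · match l₁ with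
      | [] =>
        simp only [List.nil_append, List.cons_prefix_cons] at h
        obtain ⟨rfl, rfl, t, rfl⟩ := h
        exact .inr (.inr ⟨rfl, ⟨[], rfl⟩, t, rfl⟩)
      | [e] =>
        simp only [List.cons_append, List.nil_append, List.cons_prefix_cons] at h
        obtain ⟨rfl, rfl, rfl, -⟩ := h
        exact .inl (List.infix_refl _)
      | e :: e' :: l₁ =>
        simp only [List.cons_append, List.cons_prefix_cons] at h
        obtain ⟨rfl, rfl, rfl, -⟩ := h
        exact .inl (List.IsPrefix.isInfix (by simp))
    · rcases ih h with h | h | ⟨rfl, ⟨l₁', rfl⟩, hb⟩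
      · exact .inl (List.infix_cons_iff.2 (.inr h))
      · exact .inr (.inl h)
      · exact .inr (.inr ⟨rfl, ⟨d :: l₁', rfl⟩, hb⟩)

/-- Loops can be cut out of open walks. -/
theorem IsOpenWalk.cut {G : DAG V} {S Z : Set V} (hS : ∀ a b, G.Edge a b → b ∈ S → a ∈ S)
    {l₁ l₂ l₃ : List V} {w : V} (h : G.IsOpenWalk S Z (l₁ ++ w :: (l₂ ++ w :: l₃))) :
    G.IsOpenWalk S Z (l₁ ++ w :: l₃) := by
  have hleft : l₁ ++ [w] <:+: l₁ ++ w :: (l₂ ++ w :: l₃) := List.IsPrefix.isInfix (by simp)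
  have hright : w :: l₃ <:+: l₁ ++ w :: (l₂ ++ w :: l₃) :=
    List.IsSuffix.isInfix ⟨l₁ ++ w :: l₂, by simp⟩
  refine ⟨List.isChain_split.2 ⟨h.1.infix hleft, h.1.infix hright⟩, fun a v b hi => ?_⟩
  rcases infix_append_cons hi with hi | hi | ⟨rfl, ⟨l₁, rfl⟩, l₃, rfl⟩
  · exact h.2 a v b (hi.trans hleft)
  · exact h.2 a v b (hi.trans hright)
  have hne : ∀ {x}, ¬ G.Adj x x := fun h' =>
    h'.elim (fun h => G.acyclic _ (.single h)) (fun h => G.acyclic _ (.single h))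
  obtain ⟨c, l₂', rfl⟩ : ∃ c l, l₂ = c :: l := by
    cases l₂ with
    | cons c l => exact ⟨c, l, rfl⟩
    | nil =>
      exact absurd (h.of_isInfix (l' := [v, v]) ⟨l₁ ++ [a], b :: l₃, by simp⟩).1 (by simp [hne])
  have hfirst := (h.of_isInfix (l' := a :: v :: c :: (l₂' ++ v :: b :: l₃)) ⟨l₁, [], by simp⟩)
  obtain ⟨m, d, hmd⟩ := (List.eq_nil_or_concat (c :: l₂')).resolve_left (by simp)
  have hlast := (h.of_isInfix (l' := [d, v, b]) ⟨l₁ ++ [a, v] ++ m, l₃, by simp [hmd]⟩).triple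
  constructor
  · rintro ⟨hav, hbv⟩
    by_cases hcv : G.Edge c v
    · exact hfirst.triple.1 ⟨hav, hcv⟩
    · have hvc : G.Edge v c :=
        (List.isChain_cons_cons.1 hfirst.tail.1).1.resolve_right hcv
      rcases hfirst.tail.mem_or_isChain hS hvc with hc | hc
      · exact hS v c hvc hc
      · have : [v, b].IsChain G.Edge := hc.infix ⟨v :: c :: l₂', l₃, by simp⟩
        exact absurd hbv (G.not_edge_symm (by simpa using this))
  · intro hnc hvZ
    refine hnc ⟨?_, ?_⟩
    · by_contra hav
      exact hfirst.triple.2 (fun h' => hav h'.1) hvZ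
    · by_contra hbv
      exact hlast.2 (fun h' => hbv h'.2) hvZ

theorem exists_append_of_not_nodup {l : List V} (h : ¬ l.Nodup) :
    ∃ w l₁ l₂ l₃, l = l₁ ++ w :: (l₂ ++ w :: l₃) := by
  induction l with
  | nil => simp at h
  | cons a l ih =>
    by_cases ha : a ∈ l
    · obtain ⟨s, t, rfl⟩ := List.append_of_mem ha
      exact ⟨a, [], s, t, rfl⟩
    · obtain ⟨w, l₁, l₂, l₃, rfl⟩ := ih fun h' => h (List.nodup_cons.2 ⟨ha, h'⟩)
      exact ⟨w, a :: l₁, l₂, l₃, rfl⟩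

/-- An open walk from `X` to `Y` can be shortened to an open proper path. -/
theorem IsOpenWalk.exists_proper_path {G : DAG V} {S Z X Y : Set V}
    (hS : ∀ a b, G.Edge a b → b ∈ S → a ∈ S) {l : List V} (h : G.IsOpenWalk S Z l)
    (hx : ∃ x ∈ X, l.head? = some x) (hy : ∃ y ∈ Y, l.getLast? = some y) :
    ∃ p, G.IsOpenWalk S Z p ∧ (∃ x ∈ X, p.head? = some x) ∧ (∃ y ∈ Y, p.getLast? = some y) ∧
      p.Nodup ∧ ∀ v ∈ p.tail, v ∉ X := by
  induction hn : l.length using Nat.strong_induction_on generalizing l with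
  | _ n ih =>
    by_cases hnd : l.Nodup
    · by_cases hX : ∀ v ∈ l.tail, v ∉ X
      · exact ⟨l, h, hx, hy, hnd, hX⟩
      · push Not at hX
        obtain ⟨v, hv, hvX⟩ := hX
        obtain ⟨s, t, hst⟩ := List.append_of_mem hv
        cases l with
        | nil => simp at hv
        | cons a l =>
          simp only [List.tail_cons] at hst
          subst hst
          refine ih (v :: t).length (by simp at hn ⊢; omega) (h.of_isInfix ⟨a :: s, [], by simp⟩)
            ⟨v, hvX, rfl⟩ ?_ rfl
          simpa [List.getLast?_append, List.getLast?_cons] using hy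
    · obtain ⟨w, l₁, l₂, l₃, rfl⟩ := exists_append_of_not_nodup hnd
      refine ih _ ?_ (h.cut hS) ?_ ?_ rfl
      · simp at hn ⊢
        omega
      · simpa [List.head?_append] using hx
      · simpa [List.getLast?_append, List.getLast?_cons] using hy

theorem infix_triple_unique {a w b a' b' : V} {p : List V} (hp : p.Nodup)
    (h : [a, w, b] <:+: p) (h' : [a', w, b'] <:+: p) : a = a' ∧ b = b' := by
  obtain ⟨s, t, rfl⟩ := h
  obtain ⟨s', t', he⟩ := h'
  have h1 : (s' ++ [a']) ++ w :: (b' :: t') = (s ++ [a]) ++ w :: (b :: t) := by simpa using he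
  have h2 : ((s ++ [a]) ++ w :: (b :: t)).Nodup := by simpa using hp
  have hw : ∀ {s t : List V}, (s ++ w :: t).Nodup → w ∉ s := fun hs hws => by
    simp only [List.nodup_append, List.mem_cons] at hs
    exact hs.2.2 w hws w (.inl rfl) rfl
  have h3 := hw h2
  have h4 := hw (h1 ▸ h2)
  have h5 : s' ++ [a'] = s ++ [a] ∧ w :: (b' :: t') = w :: (b :: t) := by
    have := List.append_eq_append_iff.1 h1
    rcases this with ⟨c, hc, hc'⟩ | ⟨c, hc, hc'⟩
    · cases c with
      | nil => simp_all
      | cons x c =>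
        simp only [List.cons_append, List.cons.injEq] at hc'
        exact absurd (by rw [hc, hc'.1]; simp) h3
    · cases c with
      | nil => simp_all
      | cons x c =>
        simp only [List.cons_append, List.cons.injEq] at hc'
        exact absurd (by rw [hc, hc'.1]; simp) h4
  simp at h5
  exact ⟨h5.1.2.symm, h5.2.1.symm⟩

theorem isOpenWalk_of_not_blocks {D : DAG V} {Z : Set V} {p : List V} (hp : p.Nodup)
    (hadj : p.IsChain D.Adj) (h : ¬ D.Blocks Z p) : D.IsOpenWalk (D.Anc Z) Z p := by
  refine ⟨hadj, fun a w b hi => ⟨fun hc => ?_, fun hnc hw => ?_⟩⟩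
  · by_contra hw
    refine h (.inr ⟨w, ⟨a, b, hi, hc⟩, ?_⟩)
    refine Set.eq_empty_iff_forall_notMem.2 ?_
    rintro z ⟨⟨w', rfl, hz⟩, hzZ⟩
    exact hw ⟨z, hzZ, hz⟩
  · refine h (.inl ⟨w, ⟨⟨a, b, hi⟩, ?_⟩, hw⟩)
    rintro ⟨a', b', hi', hc⟩
    obtain ⟨rfl, rfl⟩ := infix_triple_unique hp hi hi'
    exact hnc hc

theorem IsOpenWalk.not_blocks {D : DAG V} {Z : Set V} {p : List V}
    (h : D.IsOpenWalk (D.Anc Z) Z p) : ¬ D.Blocks Z p := by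
  rintro (⟨w, ⟨⟨a, b, hi⟩, hnc⟩, hw⟩ | ⟨w, ⟨a, b, hi, hc⟩, hw⟩)
  · exact (h.2 a w b hi).2 (fun hc => hnc ⟨a, b, hi, hc⟩) hw
  · obtain ⟨z, hz, hwz⟩ := (h.2 a w b hi).1 hc
    exact Set.eq_empty_iff_forall_notMem.1 hw z ⟨⟨w, rfl, hwz⟩, hz⟩

/-- Openness of a walk does not depend on the ambient graph. -/
theorem IsOpenWalk.of_edge_iff {G D : DAG V} {S Z : Set V} {l : List V}
    (hGD : ∀ a b, G.Edge a b → D.Edge a b) (h : l.IsChain G.Adj) :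
    G.IsOpenWalk S Z l ↔ D.IsOpenWalk S Z l := by
  have hiff : ∀ {a b}, G.Adj a b → (G.Edge a b ↔ D.Edge a b) := fun {a b} hab =>
    ⟨hGD a b, fun hD => hab.resolve_right fun hba => D.not_edge_symm hD (hGD b a hba)⟩
  have hch : l.IsChain D.Adj := h.imp fun a b hab => hab.imp (hGD a b) (hGD b a)
  have htr : ∀ {a w b}, [a, w, b] <:+: l →
      (G.Edge a w ∧ G.Edge b w ↔ D.Edge a w ∧ D.Edge b w) := fun {a w b} hi => by
    have h3 : [a, w, b].IsChain G.Adj := h.infix hi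
    simp only [List.isChain_cons_cons] at h3
    rw [hiff h3.1, hiff (Or.symm h3.2.1)]
  constructor
  · rintro ⟨-, h2⟩
    exact ⟨hch, fun a w b hi => by rw [← htr hi]; exact h2 a w b hi⟩
  · rintro ⟨-, h2⟩
    exact ⟨h, fun a w b hi => by rw [htr hi]; exact h2 a w b hi⟩

end DAG

namespace DAG

variable {V : Type} [Fintype V] [DecidableEq V]

theorem properBackdoor_edge {D : DAG V} {X Y : Set V} {a b : V}
    (h : (D.properBackdoor X Y).Edge a b) : D.Edge a b := h.1

theorem properBackdoor_edge_of_notMem {D : DAG V} {X Y : Set V} {a b : V} (h : D.Edge a b)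
    (ha : a ∉ X) : (D.properBackdoor X Y).Edge a b := ⟨h, fun h' => ha h'.1⟩

theorem isChain_properBackdoor {D : DAG V} {X Y : Set V} {l : List V} (h : l.IsChain D.Adj)
    (hX : ∀ v ∈ l, v ∉ X) : l.IsChain (D.properBackdoor X Y).Adj := by
  induction l with
  | nil => exact .nil
  | cons u l ih =>
    cases l with
    | nil => exact .singleton u
    | cons v l =>
      rw [List.isChain_cons_cons] at h ⊢
      refine ⟨h.1.imp (fun h => ?_) (fun h => ?_), ih h.2 fun w hw => hX w (by simp [hw])⟩
      · exact properBackdoor_edge_of_notMem h (hX u (by simp))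
      · exact properBackdoor_edge_of_notMem h (hX v (by simp))

theorem IsMoralSide.not_isOpenWalk {D : DAG V} {X Y Z P : Set V} (h : D.IsMoralSide X Y Z P)
    (hYZ : Disjoint Y Z) {u : V} {l : List V} (hu : u ∈ P)
    (hl : ∃ y ∈ Y, (u :: l).getLast? = some y) :
    ¬ (D.properBackdoor X Y).IsOpenWalk (D.Anc Z) Z (u :: l) := by
  intro ho
  set G := D.properBackdoor X Y with hG
  have hYA : ∀ y ∈ Y, y ∈ D.Anc (X ∪ Y ∪ Z) := fun y hy => D.subset_anc _ (.inl (.inr hy))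
  have hanc : D.Anc Z ⊆ D.Anc (X ∪ Y ∪ Z) := D.anc_mono Set.subset_union_right
  induction hn : l.length using Nat.strong_induction_on generalizing u l with
  | _ n ih =>
    have huA := h.subset_anc hu
    have huZ := Set.disjoint_left.1 h.disjoint_sep hu
    cases l with
    | nil =>
      obtain ⟨y, hy, he⟩ := hl
      simp only [List.getLast?_singleton, Option.some.injEq] at he
      exact Set.disjoint_left.1 h.disjoint_target hu (he ▸ hy)
    | cons v l =>
      have hl' : ∃ y ∈ Y, (v :: l).getLast? = some y := by
        simpa [List.getLast?_cons_cons] using hl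
      have hadj : G.Adj u v := (List.isChain_cons_cons.1 ho.1).1
      have hvA : v ∈ D.Anc (X ∪ Y ∪ Z) := by
        rcases hadj with huv | hvu
        · rcases ho.mem_or_isChain
            (fun a b hab hb => anc_of_edge (properBackdoor_edge hab) hb) huv with hv | hc
          · exact hanc hv
          · obtain ⟨y, hy, hlast⟩ := hl'
            have hvy := List.relationReflTransGen_of_exists_isChain_cons l
              (List.isChain_cons_cons.1 hc).2
              (List.getLast_of_getLast?_eq_some hlast)
            exact ⟨y, .inl (.inr hy), Relation.ReflTransGen.mono
              (fun _ _ h => properBackdoor_edge h) _ _ hvy⟩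
        · exact anc_of_edge (properBackdoor_edge hvu) huA
      by_cases hvZ : v ∈ Z
      · cases l with
        | nil =>
          obtain ⟨y, hy, he⟩ := hl'
          simp only [List.getLast?_singleton, Option.some.injEq] at he
          exact Set.disjoint_left.1 hYZ (he ▸ hy) hvZ
        | cons b l =>
          have hcol : G.Edge u v ∧ G.Edge b v := by
            by_contra hc
            exact ho.triple.2 hc hvZ
          have hl'' : ∃ y ∈ Y, (b :: l).getLast? = some y := by
            simpa [List.getLast?_cons_cons] using hl'
          have hbZ : b ∉ Z := by
            cases l with
            | nil =>
              obtain ⟨y, hy, he⟩ := hl''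
              simp only [List.getLast?_singleton, Option.some.injEq] at he
              exact Set.disjoint_left.1 hYZ (he ▸ hy)
            | cons d l => exact ho.tail.triple.2 fun h' => G.not_edge_symm hcol.2 h'.1
          have hbP := h.closed v hvA u b (.inr hcol.1) (.inr hcol.2) huZ hbZ hu
          refine ih l.length ?_ hbP hl'' ho.tail.tail rfl
          simp at hn
          omega
      · have hvP : v ∈ P := by
          rcases hadj with huv | hvu
          · exact h.closed v hvA u v (.inr huv) (.inl rfl) huZ hvZ hu
          · exact h.closed u huA u v (.inl rfl) (.inr hvu) huZ hvZ hu
        refine ih l.length ?_ hvP hl' ho.tail rfl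
        simp at hn
        omega

theorem IsMoralSide.blocks {D : DAG V} {X Y Z P : Set V} (h : D.IsMoralSide X Y Z P)
    (hF : Disjoint (D.Desc (D.firstMediators X Y)) Z) (hYZ : Disjoint Y Z) {p : List V}
    (hp : D.ProperNonCausalPath X Y p) : D.Blocks Z p := by
  obtain ⟨⟨x, hx, y, hy, hnd, hadj, hhead, hlast⟩, hproper, hnc⟩ := hp
  by_contra hb
  have ho := isOpenWalk_of_not_blocks hnd hadj hb
  match p with
  | [] => simp at hhead
  | [u] => exact hnc (.singleton u)
  | u :: v :: l =>
    obtain rfl : u = x := by simpa using hhead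
    replace hadj : (u :: v :: l).IsChain D.Adj := hadj
    rw [List.isChain_cons_cons] at hadj
    have hvX : v ∉ X := hproper v (by simp)
    have hG : (u :: v :: l).IsChain (D.properBackdoor X Y).Adj := by
      refine List.isChain_cons_cons.2 ⟨?_, isChain_properBackdoor hadj.2 hproper⟩
      rcases hadj.1 with huv | hvu
      · refine .inl ⟨huv, fun h' => ?_⟩
        rcases ho.mem_or_isChain (fun a b hab hb => anc_of_edge hab hb) huv with hv | hc
        · obtain ⟨z, hz, hvz⟩ := hv
          exact Set.disjoint_left.1 hF ⟨v, h'.2, hvz⟩ hz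
        · exact hnc hc
      · exact .inr (properBackdoor_edge_of_notMem hvu hvX)
    exact h.not_isOpenWalk hYZ (h.source_subset hx) ⟨y, hy, hlast⟩
      ((IsOpenWalk.of_edge_iff (fun _ _ => properBackdoor_edge) hG).2 ho)

theorem exists_reflTransGen_properBackdoor {D : DAG V} {X Y : Set V} {w : V}
    (hw : w ∈ D.Anc (X ∪ Y)) :
    ∃ s ∈ X ∪ Y, Relation.ReflTransGen (D.properBackdoor X Y).Edge w s := by
  obtain ⟨s, hs, hws⟩ := hw
  induction hws using Relation.ReflTransGen.head_induction_on with
  | refl => exact ⟨s, hs, .refl⟩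
  | @head a c hac _ ih =>
    by_cases ha : a ∈ X
    · exact ⟨a, .inl ha, .refl⟩
    · obtain ⟨t, ht, hct⟩ := ih
      exact ⟨t, ht, .head (properBackdoor_edge_of_notMem hac ha) hct⟩

/-- `v` is joined to `Y` by an open walk in the proper back-door graph. -/
def ReachesTarget (D : DAG V) (X Y Z : Set V) (v : V) : Prop :=
  ∃ l, (D.properBackdoor X Y).IsOpenWalk (D.Anc Z) Z (v :: l) ∧
    ∃ y ∈ Y, (v :: l).getLast? = some y

theorem ReachesTarget.descend {D : DAG V} {X Y Z : Set V} {w s : V}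
    (h : D.ReachesTarget X Y Z w) (hw : w ∉ D.Anc Z)
    (hws : Relation.ReflTransGen (D.properBackdoor X Y).Edge w s) : D.ReachesTarget X Y Z s := by
  induction hws with
  | refl => exact h
  | @tail b c hwb hbc ih =>
    obtain ⟨l, hl, hy⟩ := ih
    have hb : b ∉ Z := fun hbZ =>
      hw ⟨b, hbZ, Relation.ReflTransGen.mono (fun _ _ h => properBackdoor_edge h) _ _ hwb⟩
    refine ⟨b :: l, hl.cons (.inr hbc) fun d _ => ⟨fun h' => ?_, fun _ => hb⟩,
      by simpa [List.getLast?_cons_cons] using hy⟩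
    exact absurd h'.1 (DAG.not_edge_symm _ hbc)

theorem exists_directed_isOpenWalk {D : DAG V} {X Y Z : Set V} {w y : V} (hy : y ∈ Y)
    (hw : w ∉ D.Anc Z) (hwy : Relation.ReflTransGen (D.properBackdoor X Y).Edge w y) :
    ∃ l, (D.properBackdoor X Y).IsOpenWalk (D.Anc Z) Z (w :: l) ∧
      (∃ y ∈ Y, (w :: l).getLast? = some y) ∧
      ∀ b ∈ l.head?, (D.properBackdoor X Y).Edge w b := by
  induction hwy using Relation.ReflTransGen.head_induction_on with
  | refl => exact ⟨[], isOpenWalk_singleton _ _ _ _, ⟨y, hy, rfl⟩, by simp⟩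
  | @head a c hac _ ih =>
    have hc : c ∉ D.Anc Z := fun hc => hw (anc_of_edge (properBackdoor_edge hac) hc)
    obtain ⟨l, hl, hlast, hout⟩ := ih hc
    refine ⟨c :: l, hl.cons (.inl hac) fun b hb => ⟨fun h' => ?_, fun _ hcZ => ?_⟩,
      by simpa [List.getLast?_cons_cons] using hlast, by simpa using hac⟩
    · exact absurd h'.2 (DAG.not_edge_symm _ (hout b hb))
    · exact hc (D.subset_anc _ hcZ)

theorem ReachesTarget.of_edge_of_notMem_anc {D : DAG V} {X Y Z : Set V}
    (hno : ∀ x ∈ X, ¬ D.ReachesTarget X Y Z x) {v w : V} (h : D.ReachesTarget X Y Z w)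
    (hvw : (D.properBackdoor X Y).Edge v w) (hwA : w ∈ D.Anc (X ∪ Y ∪ Z)) (hw : w ∉ D.Anc Z) :
    D.ReachesTarget X Y Z v := by
  have hwXY : w ∈ D.Anc (X ∪ Y) := by
    obtain ⟨s, hs | hs, hws⟩ := hwA
    · exact ⟨s, hs, hws⟩
    · exact absurd ⟨s, hs, hws⟩ hw
  obtain ⟨s, hs | hs, hws⟩ := exists_reflTransGen_properBackdoor hwXY
  · exact absurd (h.descend hw hws) (hno s hs)
  · obtain ⟨l, hl, hlast, hout⟩ := exists_directed_isOpenWalk hs hw hws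
    refine ⟨w :: l, hl.cons (.inl hvw) fun b hb => ⟨fun h' => ?_, fun _ hwZ => ?_⟩,
      by simpa [List.getLast?_cons_cons] using hlast⟩
    · exact absurd h'.2 (DAG.not_edge_symm _ (hout b hb))
    · exact hw (D.subset_anc _ hwZ)

theorem ReachesTarget.of_mem_family {D : DAG V} {X Y Z : Set V}
    (hno : ∀ x ∈ X, ¬ D.ReachesTarget X Y Z x) {i u v : V} (hi : i ∈ D.Anc (X ∪ Y ∪ Z))
    (hu : u = i ∨ (D.properBackdoor X Y).Edge u i) (hv : v = i ∨ (D.properBackdoor X Y).Edge v i)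
    (huZ : u ∉ Z) (h : D.ReachesTarget X Y Z u) : D.ReachesTarget X Y Z v := by
  rcases hu with rfl | hui
  · rcases hv with rfl | hvu
    · exact h
    · by_cases hua : u ∈ D.Anc Z
      · obtain ⟨l, hl, hlast⟩ := h
        exact ⟨u :: l, hl.cons (.inl hvu) fun b _ => ⟨fun _ => hua, fun _ => huZ⟩,
          by simpa [List.getLast?_cons_cons] using hlast⟩
      · exact h.of_edge_of_notMem_anc hno hvu hi hua
  · have hri : ∃ l, (D.properBackdoor X Y).IsOpenWalk (D.Anc Z) Z (i :: u :: l) ∧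
        ∃ y ∈ Y, (i :: u :: l).getLast? = some y := by
      obtain ⟨l, hl, hlast⟩ := h
      refine ⟨l, hl.cons (.inr hui) fun b _ => ⟨fun h' => ?_, fun _ => huZ⟩,
        by simpa [List.getLast?_cons_cons] using hlast⟩
      exact absurd h'.1 (DAG.not_edge_symm _ hui)
    obtain ⟨l, hl, hlast⟩ := hri
    rcases hv with rfl | hvi
    · exact ⟨u :: l, hl, hlast⟩
    · by_cases hia : i ∈ D.Anc Z
      · refine ⟨i :: u :: l, hl.cons (.inl hvi) fun b hb => ⟨fun _ => hia, fun hnc => ?_⟩,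
          by simpa [List.getLast?_cons_cons] using hlast⟩
        obtain rfl : u = b := by simpa using hb
        exact absurd ⟨hvi, hui⟩ hnc
      · exact ReachesTarget.of_edge_of_notMem_anc hno ⟨u :: l, hl, hlast⟩ hvi hi hia

theorem isMoralSide_of_not_reachesTarget {D : DAG V} {X Y Z : Set V} (hXZ : Disjoint X Z)
    (hno : ∀ x ∈ X, ¬ D.ReachesTarget X Y Z x) :
    D.IsMoralSide X Y Z {v ∈ D.Anc (X ∪ Y ∪ Z) | v ∉ Z ∧ ¬ D.ReachesTarget X Y Z v} where
  subset_anc := fun v hv => hv.1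
  disjoint_sep := Set.disjoint_left.2 fun v hv => hv.2.1
  source_subset := fun x hx =>
    ⟨D.subset_anc _ (.inl (.inl hx)), Set.disjoint_left.1 hXZ hx, hno x hx⟩
  disjoint_target := Set.disjoint_left.2 fun y hy hyY =>
    hy.2.2 ⟨[], isOpenWalk_singleton _ _ _ _, y, hyY, rfl⟩
  closed := by
    rintro i hi u v hu hv - hvZ ⟨-, -, hur⟩
    refine ⟨?_, hvZ, fun hvr => hur (hvr.of_mem_family hno hi hv hu hvZ)⟩
    rcases hv with rfl | hvi
    · exact hi
    · exact anc_of_edge (properBackdoor_edge hvi) hi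

/-- An adjustment set leaves no open walk between `X` and `Y` in the proper back-door graph. -/
theorem SatisfiesAC.not_reachesTarget {D : DAG V} {X Y Z : Set V} (h : D.SatisfiesAC X Y Z)
    (hXY : Disjoint X Y) {x : V} (hx : x ∈ X) : ¬ D.ReachesTarget X Y Z x := by
  rintro ⟨l, hl, hlast⟩
  obtain ⟨p, hp, ⟨x, hx, hhead⟩, ⟨y, hy, hlast⟩, hnd, hproper⟩ := hl.exists_proper_path
    (fun a b hab hb => anc_of_edge (properBackdoor_edge hab) hb) ⟨x, hx, rfl⟩ hlast
  have hD := (IsOpenWalk.of_edge_iff (fun _ _ => properBackdoor_edge) hp.1).1 hp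
  refine hD.not_blocks (h.2 p ⟨⟨x, hx, y, hy, hnd, hD.1, hhead, hlast⟩, hproper, fun hc => ?_⟩)
  replace hc : p.IsChain D.Edge := hc
  match p with
  | [] => simp at hhead
  | [u] =>
    obtain rfl : u = x := by simpa using hhead
    obtain rfl : u = y := by simpa using hlast
    exact Set.disjoint_left.1 hXY hx hy
  | u :: v :: l =>
    obtain rfl : u = x := by simpa using hhead
    rw [List.isChain_cons_cons] at hc
    have hvy : Relation.ReflTransGen (fun a b => D.Edge a b ∧ b ∉ X) v y := by
      refine List.relationReflTransGen_of_exists_isChain_cons l ?_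
        (List.getLast_of_getLast?_eq_some (by simpa [List.getLast?_cons_cons] using hlast))
      have hc2 := hc.2
      have hprop : ∀ w ∈ v :: l, w ∉ X := hproper
      clear * - hc2 hprop
      induction l generalizing v with
      | nil => exact .singleton v
      | cons b l ih =>
        rw [List.isChain_cons_cons] at hc2 ⊢
        exact ⟨⟨hc2.1, hprop b (by simp)⟩, ih _ hc2.2 fun w hw => hprop w (by simp [hw])⟩
    have hvM : v ∈ D.firstMediators X Y := ⟨hproper v (by simp), ⟨u, hx, hc.1⟩, y, hy, hvy⟩
    rcases (List.isChain_cons_cons.1 hp.1).1 with huv | hvu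
    · exact huv.2 ⟨hx, hvM⟩
    · exact D.not_edge_symm hc.1 hvu.1

theorem desc_firstMediators_subset_forb (D : DAG V) (X Y : Set V) :
    D.Desc (D.firstMediators X Y) ⊆ D.Forb X Y := by
  rintro v ⟨w, ⟨hwX, ⟨x, hx, hxw⟩, y, hy, hwy⟩, hwv⟩
  obtain ⟨l, hl, hlast⟩ := List.exists_isChain_cons_of_relationReflTransGen hwy
  have hcausal : (x :: w :: l).IsChain D.Edge :=
    List.isChain_cons_cons.2 ⟨hxw, hl.imp fun _ _ h => h.1⟩
  refine ⟨x :: w :: l, w, ⟨⟨x, hx, y, hy, ?_, ?_, rfl, ?_⟩, ?_, hcausal⟩, by simp, hwX, hwv⟩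
  · have : (x :: w :: l).IsChain (Relation.TransGen D.Edge) := hcausal.imp fun _ _ h => .single h
    refine List.Pairwise.imp (S := (· ≠ ·)) ?_ this.pairwise
    rintro a b hab rfl
    exact D.acyclic _ hab
  · exact hcausal.imp fun _ _ h => .inl h
  · rw [List.getLast?_cons_cons, List.getLast?_eq_some_getLast (by simp), hlast]
  · have key : ∀ (l : List V) (w : V), w ∉ X →
        (w :: l).IsChain (fun a b => D.Edge a b ∧ b ∉ X) → ∀ v ∈ w :: l, v ∉ X := by
      intro l
      induction l with
      | nil => simp
      | cons b l ih =>
        intro w hw hc v hv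
        rw [List.isChain_cons_cons] at hc
        rcases List.mem_cons.1 hv with rfl | hv
        · exact hw
        · exact ih b hc.1.2 hc.2 v hv
    exact key l w hwX hl

theorem forb_subset_desc (D : DAG V) (X Y : Set V) : D.Forb X Y ⊆ D.Desc X := by
  rintro v ⟨p, w, ⟨⟨x, hx, y, -, -, -, hhead, -⟩, -, hc⟩, hwp, -, hwv⟩
  replace hc : p.IsChain D.Edge := hc
  obtain ⟨s, t, rfl⟩ := List.append_of_mem hwp
  have h1 := (List.isChain_split.1 hc).1
  have h2 := List.relationReflTransGen_of_exists_isChain _ h1 (by simp)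
  have h3 : (s ++ [w]).head (by simp) = x := by
    cases s <;> simpa using hhead
  rw [h3, List.getLast_append_singleton] at h2
  exact ⟨x, hx, h2.trans hwv⟩

/-- Enlarging the separator by ancestors of `X ∪ Y` preserves separation. -/
theorem IsMoralSide.union {D : DAG V} {X Y Z P W : Set V} (h : D.IsMoralSide X Y Z P)
    (hW : W ⊆ D.Anc (X ∪ Y)) (hXW : Disjoint X W) : D.IsMoralSide X Y (Z ∪ W) (P \ W) := by
  have hA : D.Anc (X ∪ Y ∪ (Z ∪ W)) = D.Anc (X ∪ Y ∪ Z) := by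
    refine Set.Subset.antisymm ?_ (D.anc_mono (by grind))
    rintro v ⟨s, hs, hvs⟩
    by_cases hsW : s ∈ W
    · obtain ⟨t, ht, hst⟩ := hW hsW
      exact ⟨t, .inl ht, hvs.trans hst⟩
    · exact ⟨s, by grind, hvs⟩
  refine ⟨?_, ?_, ?_, ?_, ?_⟩
  · rw [hA]
    exact Set.sdiff_subset.trans h.subset_anc
  · exact Set.disjoint_left.2 fun v hv hv' =>
      hv'.elim (Set.disjoint_left.1 h.disjoint_sep hv.1) hv.2
  · exact fun x hx => ⟨h.source_subset hx, Set.disjoint_left.1 hXW hx⟩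
  · exact h.disjoint_target.mono_left Set.sdiff_subset
  · rw [hA]
    intro i hi u v hu hv huZ hvZ huP
    exact ⟨h.closed i hi u v hu hv (fun h' => huZ (.inl h')) (fun h' => hvZ (.inl h')) huP.1,
      fun h' => hvZ (.inr h')⟩

end DAG

open DAG in
/-- Suppose `Z₀` satisfies the adjustment criterion relative to
`(X, Y)` in `D` and let `Z₁ ⊆ An(X ∪ Y, D) \ (De(X,D) ∪ Y)`, `Z = Z₀ ∪ Z₁`.  Then
(i) `X`, `Y`, `Z` are pairwise disjoint; (ii) `Z` satisfies the adjustment criterion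
relative to `(X, Y)` in `D`; and (iii) for every strictly positive pmf consistent with
`D` and every assignment, `∑_{z₀} f(y | x, z₀) f(z₀) = ∑_{z₀,z₁} f(y | x, z₀, z₁)
f(z₀, z₁)`. -/
theorem enlarged_adjustment_set
    {V : Type} [Fintype V] [DecidableEq V] {A : Type} [Fintype A] [DecidableEq A]
    (hcard : 2 ≤ Fintype.card A)
    (D : DAG V) (X Y Z₀ Z₁ : Set V)
    (hXY : Disjoint X Y) (hXZ : Disjoint X Z₀) (hYZ : Disjoint Y Z₀)
    (hX : X.Nonempty) (hY : Y.Nonempty)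
    (hAC : D.SatisfiesAC X Y Z₀)
    (hZ₁ : Z₁ ⊆ D.Anc (X ∪ Y) \ (D.Desc X ∪ Y)) :
    (Disjoint X Y ∧ Disjoint X (Z₀ ∪ Z₁) ∧ Disjoint Y (Z₀ ∪ Z₁)) ∧
    D.SatisfiesAC X Y (Z₀ ∪ Z₁) ∧
    (∀ f : (V → A) → ℝ, D.IsConsistent f → ∀ a : V → A,
        adjFormula f X Y Z₀ a = adjFormula f X Y (Z₀ ∪ Z₁) a) := by
  have hXZ₁ : Disjoint X Z₁ := Set.disjoint_left.2 fun x hx hx' => (hZ₁ hx').2 (.inl ⟨x, hx, .refl⟩)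
  have hYZ₁ : Disjoint Y Z₁ := Set.disjoint_left.2 fun y hy hy' => (hZ₁ hy').2 (.inr hy)
  have hYZ' : Disjoint Y (Z₀ ∪ Z₁) := Set.disjoint_union_right.2 ⟨hYZ, hYZ₁⟩
  have hside := isMoralSide_of_not_reachesTarget (Y := Y) hXZ fun x hx => hAC.not_reachesTarget hXY hx
  have hside' := hside.union (fun z hz => (hZ₁ hz).1) hXZ₁
  have hforb : (Z₀ ∪ Z₁) ∩ D.Forb X Y = ∅ := by
    rw [Set.union_inter_distrib_right, hAC.1, Set.empty_union, ← Set.disjoint_iff_inter_eq_empty]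
    exact Set.disjoint_left.2 fun z hz hz' => (hZ₁ hz).2 (.inl (D.forb_subset_desc X Y hz'))
  have hF : ∀ Z, Z ∩ D.Forb X Y = ∅ → Disjoint (D.Desc (D.firstMediators X Y)) Z := fun Z hZ =>
    (Set.disjoint_iff_inter_eq_empty.2 hZ).symm.mono_left (D.desc_firstMediators_subset_forb X Y)
  refine ⟨⟨hXY, Set.disjoint_union_right.2 ⟨hXZ, hXZ₁⟩, hYZ'⟩,
    ⟨hforb, fun p hp => hside'.blocks (hF _ hforb) hYZ' hp⟩, fun f hf a => ?_⟩
  rw [hside.adjFormula_eq (hF _ hAC.1) hYZ hf a, hside'.adjFormula_eq (hF _ hforb) hYZ' hf a]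
end
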